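/- arXiv:2202.01588 — 4 statements merged into one kernel-verified Lean document; each statement's English description precedes it below -/
import Mathlib

section
/- (Lemma A.6, quantum-plane form.) Let f be a positive integer, β, β' integers, and ε ∈ {+1, −1}. In the completed quantum plane A_{4f} (so Y₂Y₁ = v^{8f}·Y₁Y₂), both of the following identities of infinite ordered products hold: (i) Ψ_{v^{4f}}(v^{β'}·Y₂) · →∏_{p≥0} Ψ_{v^{2f}}(v^{β+pβ'+2pεf}·y^{(1,p)}) = Ψ_{v^{2f}}(v^{β}·Y₁) · (→∏_{p≥1} [Ψ_{v^{4f}}(v^{2β+(2p−1)β'+4(p−1)εf}·y^{(2,2p−1)}) · Ψ_{v^{f}}(v^{β+pβ'+(2p−1)εf}·y^{(1,p)})]) · Ψ_{v^{4f}}(v^{β'}·Y₂); and (ii) (←∏_{p≥0} Ψ_{v^{2f}}(v^{pβ+β'+2pεf}·y^{(p,1)})) · Ψ_{v^{4f}}(v^{β}·Y₁) = Ψ_{v^{4f}}(v^{β}·Y₁) · (←∏_{p≥1} [Ψ_{v^{f}}(v^{pβ+β'+(2p−1)εf}·y^{(p,1)}) · Ψ_{v^{4f}}(v^{(2p−1)β+2β'+4(p−1)εf}·y^{(2p−1,2)})])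 · Ψ_{v^{2f}}(v^{β'}·Y₂), where each infinite ordered product is the coefficientwise limit of its partial ordered products. -/
noncomputable section

open Filter

abbrev K : Type := RatFunc ℚ

/-- The indeterminate generator `v` of `K = ℚ(v)`. -/
def v : K := RatFunc.X

/-- The completed quantum plane: formal series `Σ c_{m,n}·Y₁^m Y₂^n`, encoded as
coefficient functions `ℕ × ℕ → K`. -/
abbrev QP : Type := (ℕ × ℕ) → K

/-- The twisted product of the completed quantum plane `A_γ`:
`(Y₁^a Y₂^b)·(Y₁^{a'} Y₂^{b'}) = v^{2γba'}·Y₁^{a+a'} Y₂^{b+b'}`, extended bilinearly and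
continuously for the coefficientwise topology. -/
def qmul (γ : ℕ) (F G : QP) : QP := fun p =>
  ∑ a ∈ Finset.range (p.1 + 1), ∑ b ∈ Finset.range (p.2 + 1),
    v ^ (2 * γ * b * (p.1 - a)) * F (a, b) * G (p.1 - a, p.2 - b)

/-- The multiplicative unit of the completed quantum plane. -/
def qone : QP := fun p => if p = (0, 0) then 1 else 0

/-- Powers in the completed quantum plane. -/
def qpow (γ : ℕ) (Z : QP) : ℕ → QP
  | 0 => qone
  | k + 1 => qmul γ Z (qpow γ Z k)

/-- The element `v^β · y^{(m,n)} = v^{β + γmn} · Y₁^m Y₂^n` of `A_γ`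
(`y^{(m,n)} := v^{γmn}·Y₁^m Y₂^n` is the normalized quantum monomial). -/
def qy (γ : ℕ) (β : ℤ) (m n : ℕ) : QP := fun p =>
  if p = (m, n) then v ^ (β + (γ : ℤ) * (m : ℤ) * (n : ℤ)) else 0

/-- The series `Σ_{j≥1} ((−1)^{j+1}/(j·(w^j − w^{−j})))·Z^j` (for `Z` with zero
constant term, the coefficient at `(m,n)` only involves `j ≤ m + n`). -/
def qarg (γ : ℕ) (w : K) (Z : QP) : QP := fun r =>
  ∑ j ∈ Finset.Icc 1 (r.1 + r.2),
    ((-1 : K) ^ (j + 1) / ((j : K) * (w ^ j - w⁻¹ ^ j))) * qpow γ Z j r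

/-- The quantum dilogarithm `Ψ_w(Z) = exp(Σ_{j≥1} ((−1)^{j+1}/(j(w^j − w^{−j})))·Z^j)`
in `A_γ`, for `Z` with zero constant term. -/
def qPsi (γ : ℕ) (w : K) (Z : QP) : QP := fun p =>
  ∑ k ∈ Finset.range (p.1 + p.2 + 1),
    ((Nat.factorial k : K)⁻¹) * qpow γ (qarg γ w Z) k p

/-- The ordered product `→∏_{p=a..b} g_p = g_a g_{a+1} ⋯ g_b` in `A_γ`. -/
def qprodR (γ : ℕ) (g : ℕ → QP) (a b : ℕ) : QP :=
  ((List.range' a (b + 1 - a)).map g).foldr (qmul γ) qone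

/-- The ordered product `←∏_{p=a..b} g_p = g_b ⋯ g_{a+1} g_a` in `A_γ`. -/
def qprodL (γ : ℕ) (g : ℕ → QP) (a b : ℕ) : QP :=
  ((List.range' a (b + 1 - a)).reverse.map g).foldr (qmul γ) qone

namespace PowerSeries

variable {F : Type*} [Field F]

lemma derivative_rescale (c : F) (f : F⟦X⟧) :
    d⁄dX F (rescale c f) = c • rescale c (d⁄dX F f) := by
  ext n
  simp only [coeff_derivative, coeff_rescale, coeff_smul, smul_eq_mul]
  ring

lemma pow_sub_inv_pow_ne_zero {w : F} (hw : w ≠ 0) (hw' : ∀ j : ℕ, 0 < j → w ^ j ≠ 1)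
    {j : ℕ} (hj : 0 < j) : w ^ j - w⁻¹ ^ j ≠ 0 := by
  intro h
  refine hw' (2 * j) (by omega) ?_
  have h0 : w ^ j ≠ 0 := pow_ne_zero _ hw
  rw [inv_pow] at h
  field_simp at h
  rw [mul_comm, pow_mul]
  linear_combination h

section ExpSubst

variable [Algebra ℚ F]

lemma constantCoeff_exp_subst {g : F⟦X⟧} (hg : constantCoeff g = 0) :
    constantCoeff ((exp F).subst g) = 1 := by
  rw [← coeff_zero_eq_constantCoeff_apply, coeff_subst' (HasSubst.of_constantCoeff_zero' hg),
    finsum_eq_single _ 0]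
  · simp
  · intro n hn
    simp [hg, hn]

lemma derivative_exp_subst {g : F⟦X⟧} (hg : constantCoeff g = 0) :
    d⁄dX F ((exp F).subst g) = (exp F).subst g * d⁄dX F g := by
  rw [derivative_subst (HasSubst.of_constantCoeff_zero' hg), derivative_exp]

lemma coeff_exp_subst {g : F⟦X⟧} (hg : constantCoeff g = 0) {n N : ℕ} (h : n ≤ N) :
    coeff n ((exp F).subst g) =
      ∑ k ∈ Finset.range (N + 1), ((Nat.factorial k : F)⁻¹) * coeff n (g ^ k) := by
  rw [coeff_subst' (HasSubst.of_constantCoeff_zero' hg), finsum_eq_sum_of_support_subset]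
  · refine Finset.sum_congr rfl fun k _ => ?_
    simp [coeff_exp]
  · intro k hk
    by_contra hk'
    refine hk ?_
    have hlt : n < k := by
      simp only [Finset.coe_range, Set.mem_Iio, not_lt] at hk'
      omega
    have : (X : F⟦X⟧) ^ k ∣ g ^ k := pow_dvd_pow_of_dvd (X_dvd_iff.mpr hg) k
    simp [X_pow_dvd_iff.mp this n hlt]

end ExpSubst

variable [CharZero F]

/-- A power series is determined by its constant term and its logarithmic derivative. -/
lemma eq_of_derivative_eq_mul {f g h : F⟦X⟧} (hf : d⁄dX F f = f * h) (hg : d⁄dX F g = g * h)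
    (hf0 : constantCoeff f = 1) (hg0 : constantCoeff g = 1) : f = g := by
  have hgi : g * g⁻¹ = 1 := PowerSeries.mul_inv_cancel g (by simp [hg0])
  have key : f * g⁻¹ = 1 := by
    refine derivative.ext ?_ (by simp [hf0, hg0])
    rw [Derivation.leibniz, derivative_inv', hf, hg]
    simp only [smul_eq_mul, Derivation.map_one_eq_zero]
    linear_combination (- f * h * g⁻¹) * hgi
  calc f = f * (g * g⁻¹) := by rw [hgi, mul_one]
    _ = f * g⁻¹ * g := by ring
    _ = g := by rw [key, one_mul]

/-- The exponent of the quantum dilogarithm with parameter `w`, as a formal power series. -/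
def qdilogArg (w : F) : F⟦X⟧ :=
  mk fun j => (-1 : F) ^ (j + 1) / ((j : F) * (w ^ j - w⁻¹ ^ j))

lemma constantCoeff_qdilogArg (w : F) : constantCoeff (qdilogArg w) = 0 := by
  simp [qdilogArg, ← coeff_zero_eq_constantCoeff_apply]

lemma derivative_rescale_sq_qdilogArg {w : F} (hw : w ≠ 0) (hw' : ∀ j : ℕ, 0 < j → w ^ j ≠ 1) :
    d⁄dX F (rescale (w ^ 2) (qdilogArg w)) * (1 + w • X) =
      d⁄dX F (qdilogArg w) * (1 + w • X) + C w := by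
  have key : d⁄dX F (rescale (w ^ 2) (qdilogArg w)) =
      d⁄dX F (qdilogArg w) + mk fun n => (-1) ^ n * w ^ (n + 1) := by
    ext n
    have h1 := pow_sub_inv_pow_ne_zero hw hw' n.succ_pos
    have h2 : ((n : F) + 1) ≠ 0 := by exact_mod_cast n.succ_ne_zero
    have h3 : w ^ (n + 1) ≠ 0 := pow_ne_zero _ hw
    simp only [map_add, coeff_derivative, coeff_rescale, qdilogArg, coeff_mk, Nat.succ_eq_add_one,
      Nat.cast_add, Nat.cast_one] at h1 ⊢
    have h4 : (w ^ 2) ^ (n + 1) = w ^ (n + 1) * (w ^ (n + 1) - w⁻¹ ^ (n + 1)) + 1 := by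
      rw [inv_pow]
      field_simp
      ring
    rw [h4]
    generalize w⁻¹ ^ (n + 1) = b at h1 ⊢
    generalize w ^ (n + 1) = a at h1 ⊢
    field_simp
    ring
  rw [key, add_mul, add_right_inj]
  ext n
  rw [mul_add, mul_one, mul_smul_comm, map_add, coeff_smul, coeff_C]
  cases n with
  | zero => simp
  | succ n =>
    simp only [coeff_mk, coeff_succ_mul_X, smul_eq_mul, Nat.succ_ne_zero, if_false]
    ring

variable [Algebra ℚ F]

/-- The quantum dilogarithm with parameter `w`, as a formal power series. -/
def qdilog (w : F) : F⟦X⟧ := (exp F).subst (qdilogArg w)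

lemma constantCoeff_qdilog (w : F) : constantCoeff (qdilog w) = 1 :=
  constantCoeff_exp_subst (constantCoeff_qdilogArg w)

lemma derivative_qdilog (w : F) : d⁄dX F (qdilog w) = qdilog w * d⁄dX F (qdilogArg w) :=
  derivative_exp_subst (constantCoeff_qdilogArg w)

lemma constantCoeff_rescale_qdilog (c w : F) : constantCoeff (rescale c (qdilog w)) = 1 := by
  rw [← coeff_zero_eq_constantCoeff_apply, coeff_rescale, coeff_zero_eq_constantCoeff_apply,
    constantCoeff_qdilog, pow_zero, one_mul]

lemma derivative_rescale_qdilog (c w : F) :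
    d⁄dX F (rescale c (qdilog w)) =
      rescale c (qdilog w) * d⁄dX F (rescale c (qdilogArg w)) := by
  rw [derivative_rescale, derivative_rescale, derivative_qdilog, map_mul, mul_smul_comm]

variable {w : F}

/-- The `q`-difference equation of the quantum dilogarithm. -/
lemma rescale_sq_qdilog (hw : w ≠ 0) (hw' : ∀ j : ℕ, 0 < j → w ^ j ≠ 1) :
    rescale (w ^ 2) (qdilog w) = (1 + w • X) * qdilog w := by
  refine eq_of_derivative_eq_mul (derivative_rescale_qdilog _ _) ?_
    (constantCoeff_rescale_qdilog _ _) (by simp [constantCoeff_qdilog])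
  have hC : d⁄dX F (1 + w • X : F⟦X⟧) = C w := by
    simp [smul_eq_C_mul]
  rw [Derivation.leibniz, hC, derivative_qdilog]
  simp only [smul_eq_mul]
  linear_combination (- qdilog w) * derivative_rescale_sq_qdilogArg hw hw'

/-- The doubling formula of the quantum dilogarithm. -/
lemma qdilog_eq_mul (hw : w ≠ 0) (hw' : ∀ j : ℕ, 0 < j → w ^ j ≠ 1) :
    qdilog w = rescale w⁻¹ (qdilog (w ^ 2)) * rescale w (qdilog (w ^ 2)) := by
  refine eq_of_derivative_eq_mul (derivative_qdilog w) ?_ (constantCoeff_qdilog w)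
    (by rw [map_mul, constantCoeff_rescale_qdilog, constantCoeff_rescale_qdilog, one_mul])
  have hsum : qdilogArg w = rescale w⁻¹ (qdilogArg (w ^ 2)) + rescale w (qdilogArg (w ^ 2)) := by
    ext n
    simp only [map_add, coeff_rescale, qdilogArg, coeff_mk]
    rcases Nat.eq_zero_or_pos n with rfl | hn
    · simp
    have h1 := pow_sub_inv_pow_ne_zero hw hw' hn
    have h2 : (n : F) ≠ 0 := by exact_mod_cast hn.ne'
    have h3 := pow_sub_inv_pow_ne_zero (w := w ^ 2) (pow_ne_zero _ hw)
      (fun j hj => by rw [← pow_mul]; exact hw' _ (by omega)) hn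
    have h5 : (w ^ 2) ^ n - (w ^ 2)⁻¹ ^ n = (w ^ n - w⁻¹ ^ n) * (w ^ n + w⁻¹ ^ n) := by
      rw [← inv_pow]
      ring
    rw [h5] at h3 ⊢
    have h6 := right_ne_zero_of_mul h3
    generalize w⁻¹ ^ n = b at *
    generalize w ^ n = a at *
    field_simp
    ring
  rw [Derivation.leibniz, derivative_rescale_qdilog, derivative_rescale_qdilog, hsum, map_add]
  simp only [smul_eq_mul]
  ring

end PowerSeries

/-- The completed quantum plane `A_γ` as a type carrying its ring structure. -/
def QuantumPlane (_γ : ℕ) : Type := QP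

namespace QuantumPlane

variable {γ : ℕ}

instance : AddCommGroup (QuantumPlane γ) := inferInstanceAs (AddCommGroup ((ℕ × ℕ) → K))

instance : Module K (QuantumPlane γ) := inferInstanceAs (Module K ((ℕ × ℕ) → K))

instance : Mul (QuantumPlane γ) := ⟨qmul γ⟩

instance : One (QuantumPlane γ) := ⟨qone⟩

/-- The coefficient of a series at a monomial. -/
def coeff (p : ℕ × ℕ) : QuantumPlane γ →ₗ[K] K := LinearMap.proj (φ := fun _ : ℕ × ℕ => K) p

lemma coeff_one (p : ℕ × ℕ) :
    coeff p (1 : QuantumPlane γ) = if p = (0, 0) then 1 else 0 := rfl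

lemma coeff_mul_range (F G : QuantumPlane γ) (p : ℕ × ℕ) :
    coeff p (F * G) = ∑ a ∈ Finset.range (p.1 + 1), ∑ b ∈ Finset.range (p.2 + 1),
      v ^ (2 * γ * b * (p.1 - a)) * coeff (a, b) F * coeff (p.1 - a, p.2 - b) G := rfl

lemma coeff_mul (F G : QuantumPlane γ) (p : ℕ × ℕ) :
    coeff p (F * G) = ∑ a ∈ Finset.HasAntidiagonal.antidiagonal p.1,
      ∑ b ∈ Finset.HasAntidiagonal.antidiagonal p.2,
      v ^ (2 * γ * b.1 * a.2) * coeff (a.1, b.1) F * coeff (a.2, b.2) G := by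
  simp only [coeff_mul_range, Finset.Nat.sum_antidiagonal_eq_sum_range_succ_mk]

@[ext] lemma ext {F G : QuantumPlane γ} (h : ∀ p, coeff p F = coeff p G) : F = G := funext h

lemma mul_assoc' (F G H : QuantumPlane γ) : F * G * H = F * (G * H) := by
  ext p
  simp only [coeff_mul, ← Finset.sum_product', Finset.sum_mul, Finset.mul_sum, Finset.sum_sigma']
  apply Finset.sum_nbij'
    (fun ⟨(_, a₂), ⟨(_, b₂), ((c₁, c₂), (d₁, d₂))⟩⟩ =>
      ⟨(c₁, c₂ + a₂), ⟨(d₁, d₂ + b₂), ((c₂, a₂), (d₂, b₂))⟩⟩)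
    (fun ⟨(a₁, _), ⟨(b₁, _), ((c₁, c₂), (d₁, d₂))⟩⟩ =>
      ⟨(a₁ + c₁, c₂), ⟨(b₁ + d₁, d₂), ((a₁, c₁), (b₁, d₁))⟩⟩)
  · rintro ⟨⟨a₁, a₂⟩, ⟨⟨b₁, b₂⟩, ⟨⟨c₁, c₂⟩, ⟨d₁, d₂⟩⟩⟩⟩ h
    simp only [Finset.mem_sigma, Finset.mem_product, Finset.HasAntidiagonal.mem_antidiagonal,
      and_true] at h ⊢
    obtain ⟨h₁, h₂, rfl, rfl⟩ := h
    refine ⟨?_, ?_⟩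
    · rw [← h₁]
      ac_rfl
    · rw [← h₂]
      ac_rfl
  · rintro ⟨⟨a₁, a₂⟩, ⟨⟨b₁, b₂⟩, ⟨⟨c₁, c₂⟩, ⟨d₁, d₂⟩⟩⟩⟩ h
    simp only [Finset.mem_sigma, Finset.mem_product, Finset.HasAntidiagonal.mem_antidiagonal,
      and_true] at h ⊢
    obtain ⟨h₁, h₂, rfl, rfl⟩ := h
    refine ⟨?_, ?_⟩
    · rw [← h₁]
      ac_rfl
    · rw [← h₂]
      ac_rfl
  · rintro ⟨⟨a₁, a₂⟩, ⟨⟨b₁, b₂⟩, ⟨⟨c₁, c₂⟩, ⟨d₁, d₂⟩⟩⟩⟩ h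
    simp only [Finset.mem_sigma, Finset.mem_product, Finset.HasAntidiagonal.mem_antidiagonal] at h
    obtain ⟨-, -, rfl, rfl⟩ := h
    rfl
  · rintro ⟨⟨a₁, a₂⟩, ⟨⟨b₁, b₂⟩, ⟨⟨c₁, c₂⟩, ⟨d₁, d₂⟩⟩⟩⟩ h
    simp only [Finset.mem_sigma, Finset.mem_product, Finset.HasAntidiagonal.mem_antidiagonal] at h
    obtain ⟨-, -, rfl, rfl⟩ := h
    rfl
  · rintro ⟨⟨a₁, a₂⟩, ⟨⟨b₁, b₂⟩, ⟨⟨c₁, c₂⟩, ⟨d₁, d₂⟩⟩⟩⟩ h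
    simp only [Finset.mem_sigma, Finset.mem_product, Finset.HasAntidiagonal.mem_antidiagonal] at h
    obtain ⟨-, -, rfl, rfl⟩ := h
    ring

lemma one_mul' (F : QuantumPlane γ) : 1 * F = F := by
  ext p
  rw [coeff_mul_range, Finset.sum_eq_single 0, Finset.sum_eq_single 0]
  · simp [coeff_one]
  · intro b _ hb
    simp [coeff_one, hb]
  · simp
  · intro a _ ha
    simp [coeff_one, ha]
  · simp

lemma mul_one' (F : QuantumPlane γ) : F * 1 = F := by
  ext p
  rw [coeff_mul, Finset.sum_eq_single (p.1, 0), Finset.sum_eq_single (p.2, 0)]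
  · simp [coeff_one]
  · rintro ⟨b, c⟩ hb hne
    have : c ≠ 0 := by
      rintro rfl
      simp_all
    simp [coeff_one, this]
  · simp
  · rintro ⟨b, c⟩ hb hne
    have : c ≠ 0 := by
      rintro rfl
      simp_all
    simp [coeff_one, this]
  · simp

instance : Ring (QuantumPlane γ) where
  __ := (inferInstance : AddCommGroup (QuantumPlane γ))
  mul_assoc := mul_assoc'
  one_mul := one_mul'
  mul_one := mul_one'
  zero_mul F := by
    ext p
    simp [coeff_mul, map_zero]
  mul_zero F := by
    ext p
    simp [coeff_mul, map_zero]
  left_distrib F G H := by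
    ext p
    simp [coeff_mul, map_add, mul_add, Finset.sum_add_distrib]
  right_distrib F G H := by
    ext p
    simp [coeff_mul, map_add, mul_add, add_mul, Finset.sum_add_distrib]

instance : Algebra K (QuantumPlane γ) := Algebra.ofModule
  (fun c F G => by
    ext p
    simp only [coeff_mul, map_smul, smul_eq_mul, Finset.mul_sum]
    exact Finset.sum_congr rfl fun _ _ => Finset.sum_congr rfl fun _ _ => by ring)
  (fun c F G => by
    ext p
    simp only [coeff_mul, map_smul, smul_eq_mul, Finset.mul_sum]
    exact Finset.sum_congr rfl fun _ _ => Finset.sum_congr rfl fun _ _ => by ring)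

lemma qpow_eq_pow (Z : QuantumPlane γ) (k : ℕ) : qpow γ Z k = Z ^ k := by
  induction k with
  | zero => rfl
  | succ k ih =>
    rw [pow_succ', ← ih]
    rfl

/-! ### Truncation -/

/-- Two series agree up to total degree `N`. -/
def EqUpTo (N : ℕ) (F G : QuantumPlane γ) : Prop :=
  ∀ p : ℕ × ℕ, p.1 + p.2 ≤ N → coeff p F = coeff p G

namespace EqUpTo

variable {N : ℕ} {F F' G G' H : QuantumPlane γ}

lemma refl (F : QuantumPlane γ) : EqUpTo N F F := fun _ _ => rfl

lemma symm (h : EqUpTo N F G) : EqUpTo N G F := fun p hp => (h p hp).symm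

lemma trans (h : EqUpTo N F G) (h' : EqUpTo N G H) : EqUpTo N F H :=
  fun p hp => (h p hp).trans (h' p hp)

lemma mul (h : EqUpTo N F F') (h' : EqUpTo N G G') : EqUpTo N (F * G) (F' * G') := by
  intro p hp
  rw [coeff_mul, coeff_mul]
  refine Finset.sum_congr rfl fun a ha => Finset.sum_congr rfl fun b hb => ?_
  simp only [Finset.HasAntidiagonal.mem_antidiagonal] at ha hb
  rw [h (a.1, b.1) (by dsimp only; omega), h' (a.2, b.2) (by dsimp only; omega)]

lemma pow (h : EqUpTo N F F') (k : ℕ) : EqUpTo N (F ^ k) (F' ^ k) := by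
  induction k with
  | zero => exact refl _
  | succ k ih => exact ih.mul h

end EqUpTo

lemma ext_of_eqUpTo {F G : QuantumPlane γ} (h : ∀ N, EqUpTo N F G) : F = G :=
  ext fun p => h _ p le_rfl

/-! ### Substitution into power series in one variable -/

lemma coeff_pow_eq_zero {Z : QuantumPlane γ} (hZ : coeff (0, 0) Z = 0) {k : ℕ} {p : ℕ × ℕ}
    (hp : p.1 + p.2 < k) : coeff p (Z ^ k) = 0 := by
  induction k generalizing p with
  | zero => omega
  | succ k ih =>
    rw [pow_succ, coeff_mul]
    refine Finset.sum_eq_zero fun a ha => Finset.sum_eq_zero fun b hb => ?_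
    simp only [Finset.HasAntidiagonal.mem_antidiagonal] at ha hb
    by_cases h : a.1 + b.1 < k
    · rw [ih h, mul_zero, zero_mul]
    · have ha2 : a.2 = 0 := by omega
      have hb2 : b.2 = 0 := by omega
      rw [ha2, hb2, hZ, mul_zero]

/-- The value at `Z` of a formal power series in one variable; meaningful for `Z` with zero
constant term. -/
def qeval (f : PowerSeries K) (Z : QuantumPlane γ) : QuantumPlane γ := fun p =>
  ∑ k ∈ Finset.range (p.1 + p.2 + 1), PowerSeries.coeff k f * coeff p (Z ^ k)

variable {Z : QuantumPlane γ}

lemma coeff_qeval (f : PowerSeries K) (Z : QuantumPlane γ) (p : ℕ × ℕ) :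
    coeff p (qeval f Z) =
      ∑ k ∈ Finset.range (p.1 + p.2 + 1), PowerSeries.coeff k f * coeff p (Z ^ k) := rfl

lemma qeval_eqUpTo (hZ : coeff (0, 0) Z = 0) (f : PowerSeries K) (N : ℕ) :
    EqUpTo N (qeval f Z) (∑ k ∈ Finset.range (N + 1), PowerSeries.coeff k f • Z ^ k) := by
  intro p hp
  simp only [map_sum, coeff_qeval, map_smul, smul_eq_mul]
  refine Finset.sum_subset (Finset.range_mono (by omega)) fun k _ hk => ?_
  rw [coeff_pow_eq_zero hZ (by simpa using hk), mul_zero]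

lemma aeval_eqUpTo (hZ : coeff (0, 0) Z = 0) {f : PowerSeries K} {N : ℕ} {P : Polynomial K}
    (hP : ∀ k ≤ N, P.coeff k = PowerSeries.coeff k f) :
    EqUpTo N (Polynomial.aeval Z P) (qeval f Z) := by
  intro p hp
  rw [Polynomial.aeval_eq_sum_range' (n := N + 1 + P.natDegree) (by omega), coeff_qeval, map_sum]
  symm
  refine Finset.sum_subset_zero_on_sdiff (Finset.range_mono (by omega)) ?_ ?_
  · intro k hk
    simp only [Finset.mem_sdiff, Finset.mem_range, not_lt] at hk
    rw [map_smul, smul_eq_mul, coeff_pow_eq_zero hZ (by omega), mul_zero]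
  · intro k hk
    simp only [Finset.mem_range] at hk
    rw [map_smul, smul_eq_mul, hP k (by omega)]

lemma qeval_mul (hZ : coeff (0, 0) Z = 0) (f g : PowerSeries K) :
    qeval (f * g) Z = qeval f Z * qeval g Z := by
  refine ext_of_eqUpTo fun N => ?_
  have hf := aeval_eqUpTo hZ (f := f) (N := N) (P := f.trunc (N + 1))
    fun k hk => by rw [PowerSeries.coeff_trunc, if_pos (by omega)]
  have hg := aeval_eqUpTo hZ (f := g) (N := N) (P := g.trunc (N + 1))
    fun k hk => by rw [PowerSeries.coeff_trunc, if_pos (by omega)]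
  have hfg := aeval_eqUpTo hZ (f := f * g) (N := N) (P := f.trunc (N + 1) * g.trunc (N + 1))
    fun k hk => by
      rw [PowerSeries.coeff_mul_eq_coeff_trunc_mul_trunc f g (show k < N + 1 by omega),
        ← Polynomial.coe_mul, Polynomial.coeff_coe]
  rw [map_mul] at hfg
  exact hfg.symm.trans (hf.mul hg)

lemma qeval_one (hZ : coeff (0, 0) Z = 0) : qeval 1 Z = 1 := by
  refine ext_of_eqUpTo fun N => ?_
  have := aeval_eqUpTo hZ (f := 1) (N := N) (P := 1)
    fun k _ => by rw [Polynomial.coeff_one, PowerSeries.coeff_one]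
  rw [map_one] at this
  exact this.symm

lemma qeval_one_add_smul_X (hZ : coeff (0, 0) Z = 0) (c : K) :
    qeval (1 + c • PowerSeries.X) Z = 1 + c • Z := by
  refine ext_of_eqUpTo fun N => ?_
  have := aeval_eqUpTo hZ (f := 1 + c • PowerSeries.X) (N := N) (P := 1 + c • Polynomial.X)
    fun k _ => by
      simp [Polynomial.coeff_one, PowerSeries.coeff_one, Polynomial.coeff_X, PowerSeries.coeff_X,
        eq_comm]
  simp only [map_add, map_one, map_smul, Polynomial.aeval_X] at this
  exact this.symm

lemma qeval_pow (hZ : coeff (0, 0) Z = 0) (f : PowerSeries K) (k : ℕ) :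
    qeval (f ^ k) Z = qeval f Z ^ k := by
  induction k with
  | zero => rw [pow_zero, pow_zero, qeval_one hZ]
  | succ k ih => rw [pow_succ, pow_succ, qeval_mul hZ, ih]

lemma qeval_smul (f : PowerSeries K) (c : K) :
    qeval f (c • Z) = qeval (PowerSeries.rescale c f) Z := by
  ext p
  rw [coeff_qeval, coeff_qeval]
  refine Finset.sum_congr rfl fun k _ => ?_
  rw [smul_pow, map_smul, smul_eq_mul, PowerSeries.coeff_rescale]
  ring

lemma mul_qeval {T : QuantumPlane γ} {c : K} (hZ : coeff (0, 0) Z = 0) (h : T * Z = c • (Z * T))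
    (f : PowerSeries K) : T * qeval f Z = qeval (PowerSeries.rescale c f) Z * T := by
  have hpow : ∀ k : ℕ, T * Z ^ k = c ^ k • (Z ^ k * T) := by
    intro k
    induction k with
    | zero => simp
    | succ k ih =>
      rw [pow_succ, ← mul_assoc, ih, smul_mul_assoc, mul_assoc, h, mul_smul_comm, smul_smul,
        ← mul_assoc, pow_succ]
  refine ext_of_eqUpTo fun N => ?_
  refine ((EqUpTo.refl T).mul (qeval_eqUpTo hZ f N)).trans
    (EqUpTo.trans ?_ ((qeval_eqUpTo hZ _ N).mul (EqUpTo.refl T)).symm)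
  rw [Finset.mul_sum, Finset.sum_mul]
  convert EqUpTo.refl _ using 2
  rw [mul_smul_comm, hpow, smul_smul, smul_mul_assoc, PowerSeries.coeff_rescale, mul_comm]

lemma qeval_mul_comm {T : QuantumPlane γ} {c : K} (hZ : coeff (0, 0) Z = 0)
    (h : Z * T = c • (T * Z)) (f : PowerSeries K) : qeval f Z * T = T * qeval (PowerSeries.rescale c f) Z := by
  have hpow : ∀ k : ℕ, Z ^ k * T = c ^ k • (T * Z ^ k) := by
    intro k
    induction k with
    | zero => simp
    | succ k ih =>
      rw [pow_succ', mul_assoc, ih, mul_smul_comm, ← mul_assoc, h, smul_mul_assoc, smul_smul,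
        mul_assoc, ← pow_succ', ← pow_succ]
  refine ext_of_eqUpTo fun N => ?_
  refine ((qeval_eqUpTo hZ f N).mul (EqUpTo.refl T)).trans
    (EqUpTo.trans ?_ ((EqUpTo.refl T).mul (qeval_eqUpTo hZ _ N)).symm)
  rw [Finset.mul_sum, Finset.sum_mul]
  convert EqUpTo.refl _ using 2
  rw [smul_mul_assoc, hpow, smul_smul, mul_smul_comm, PowerSeries.coeff_rescale, mul_comm]

lemma qPsi_eq_qeval (hZ : coeff (0, 0) Z = 0) (w : K) :
    qPsi γ w Z = qeval (PowerSeries.qdilog w) Z := by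
  have harg : qarg γ w Z = qeval (PowerSeries.qdilogArg w) Z := by
    funext r
    have h := coeff_qeval (PowerSeries.qdilogArg w) Z r
    rw [Finset.range_eq_Ico, Finset.sum_eq_sum_Ico_succ_bot (by omega),
      PowerSeries.coeff_zero_eq_constantCoeff_apply, PowerSeries.constantCoeff_qdilogArg,
      zero_mul, zero_add] at h
    refine Eq.trans ?_ h.symm
    refine Finset.sum_congr rfl fun j _ => ?_
    rw [PowerSeries.qdilogArg, PowerSeries.coeff_mk, ← qpow_eq_pow]
    rfl
  have h : ∀ (k : ℕ) (p : ℕ × ℕ), qpow γ (qarg γ w Z) k p =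
      ∑ j ∈ Finset.range (p.1 + p.2 + 1),
        PowerSeries.coeff j (PowerSeries.qdilogArg w ^ k) * coeff p (Z ^ j) := by
    intro k p
    rw [← coeff_qeval, qeval_pow hZ, ← qpow_eq_pow, harg]
    rfl
  funext p
  refine Eq.trans ?_ (coeff_qeval _ Z p).symm
  simp only [qPsi, h, Finset.mul_sum]
  rw [Finset.sum_comm]
  refine Finset.sum_congr rfl fun j hj => ?_
  rw [PowerSeries.qdilog, PowerSeries.coeff_exp_subst (PowerSeries.constantCoeff_qdilogArg w)
    (N := p.1 + p.2) (by simpa [Nat.lt_succ_iff] using hj), Finset.sum_mul]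
  exact Finset.sum_congr rfl fun _ _ => by ring

/-! ### Monomials -/

/-- The monomial `v^β · y^{(m,n)}`. -/
def mon (β : ℤ) (m n : ℕ) : QuantumPlane γ := qy γ β m n

lemma coeff_mon (β : ℤ) (m n : ℕ) (p : ℕ × ℕ) :
    coeff p (mon β m n : QuantumPlane γ) =
      if p = (m, n) then v ^ (β + (γ : ℤ) * (m : ℤ) * (n : ℤ)) else 0 := rfl

lemma v_ne_zero : v ≠ 0 := RatFunc.X_ne_zero

lemma mon_mul_mon (β β' : ℤ) (m n m' n' : ℕ) :
    (mon β m n * mon β' m' n' : QuantumPlane γ) =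
      mon (β + β' + γ * (n * m' - m * n')) (m + m') (n + n') := by
  ext ⟨p, q⟩
  rw [coeff_mul, coeff_mon]
  by_cases h : (p, q) = (m + m', n + n')
  · obtain ⟨rfl, rfl⟩ := Prod.mk.inj h
    rw [if_pos rfl, Finset.sum_eq_single (m, m'), Finset.sum_eq_single (n, n')]
    · rw [coeff_mon, coeff_mon, if_pos rfl, if_pos rfl, ← zpow_natCast, ← zpow_add₀ v_ne_zero,
        ← zpow_add₀ v_ne_zero]
      congr 1
      push_cast
      ring
    · rintro ⟨b, b'⟩ hb hne
      simp only [coeff_mon, Prod.mk.injEq]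
      by_cases h1 : b = n
      · have : b' ≠ n' := by
          rintro rfl
          exact hne (by rw [h1])
        simp [this]
      · simp [h1]
    · simp
    · rintro ⟨b, b'⟩ hb hne
      refine Finset.sum_eq_zero fun c hc => ?_
      simp only [coeff_mon, Prod.mk.injEq]
      by_cases h1 : b = m
      · have : b' ≠ m' := by
          rintro rfl
          exact hne (by rw [h1])
        simp [this]
      · simp [h1]
    · simp
  · rw [if_neg h]
    refine Finset.sum_eq_zero fun a ha => Finset.sum_eq_zero fun b hb => ?_
    rw [Finset.HasAntidiagonal.mem_antidiagonal] at ha hb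
    rw [coeff_mon, coeff_mon]
    by_cases h1 : (a.1, b.1) = (m, n)
    · rw [if_neg (c := (a.2, b.2) = (m', n')), mul_zero]
      intro h2
      refine h ?_
      simp only [Prod.mk.injEq] at h1 h2 ⊢
      dsimp only at ha hb
      omega
    · rw [if_neg h1, mul_zero, zero_mul]

lemma zpow_smul_mon (t β : ℤ) (m n : ℕ) :
    v ^ t • (mon β m n : QuantumPlane γ) = mon (t + β) m n := by
  ext p
  rw [map_smul, coeff_mon, coeff_mon, smul_eq_mul, mul_ite, mul_zero, ← zpow_add₀ v_ne_zero,
    add_assoc]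

lemma pow_smul_mon (t : ℕ) (β : ℤ) (m n : ℕ) :
    v ^ t • (mon β m n : QuantumPlane γ) = mon (t + β) m n := by
  rw [← zpow_natCast, zpow_smul_mon]

lemma coeff_mon_eq_zero {β : ℤ} {m n : ℕ} {p : ℕ × ℕ} (h : p.1 + p.2 < m + n) :
    coeff p (mon β m n : QuantumPlane γ) = 0 := by
  rw [coeff_mon, if_neg]
  rintro rfl
  exact lt_irrefl _ h

/-! ### Rescaling the first variable -/

/-- The function underlying `scale`. -/
def scaleFun (c : K) (F : QuantumPlane γ) : QuantumPlane γ := fun p => c ^ p.1 * coeff p F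

lemma coeff_scaleFun (c : K) (F : QuantumPlane γ) (p : ℕ × ℕ) :
    coeff p (scaleFun c F) = c ^ p.1 * coeff p F := rfl

/-- The endomorphism `Y₁ ↦ c • Y₁`, `Y₂ ↦ Y₂`. -/
def scale (c : K) : QuantumPlane γ →+* QuantumPlane γ where
  toFun := scaleFun c
  map_one' := by
    ext p
    rw [coeff_scaleFun, coeff_one]
    split_ifs with h
    · simp [h]
    · simp
  map_zero' := by
    ext p
    rw [coeff_scaleFun, map_zero, mul_zero]
  map_add' F G := by
    ext p
    rw [map_add]
    simp only [coeff_scaleFun, map_add, mul_add]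
  map_mul' F G := by
    ext p
    rw [coeff_scaleFun, coeff_mul, coeff_mul, Finset.mul_sum]
    refine Finset.sum_congr rfl fun a ha => ?_
    rw [Finset.mul_sum]
    refine Finset.sum_congr rfl fun b _ => ?_
    rw [Finset.HasAntidiagonal.mem_antidiagonal] at ha
    rw [coeff_scaleFun, coeff_scaleFun, ← ha]
    ring

lemma coeff_scale (c : K) (F : QuantumPlane γ) (p : ℕ × ℕ) :
    coeff p (scale c F) = c ^ p.1 * coeff p F := rfl

lemma scale_smul (c t : K) (F : QuantumPlane γ) : scale c (t • F) = t • scale c F := by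
  ext p
  simp only [coeff_scale, map_smul, smul_eq_mul]
  ring

lemma scale_mon (c : K) (β : ℤ) (m n : ℕ) :
    scale c (mon β m n : QuantumPlane γ) = c ^ m • mon β m n := by
  ext p
  rw [coeff_scale, map_smul, coeff_mon]
  split_ifs with h
  · rw [h, smul_eq_mul]
  · simp

lemma scale_qeval (c : K) (f : PowerSeries K) : scale c (qeval f Z) = qeval f (scale c Z) := by
  ext p
  rw [coeff_scale, coeff_qeval, coeff_qeval, Finset.mul_sum]
  refine Finset.sum_congr rfl fun k _ => ?_
  rw [← map_pow, coeff_scale]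
  ring

/-- A series is determined by its value at `Y₁ = 0` and a `q`-difference equation in `Y₁`. -/
lemma eq_of_scale_eq {c : K} (hc : ∀ j : ℕ, 0 < j → c ^ j ≠ 1) {F G T : QuantumPlane γ}
    (hT : scale 0 T = 0) (hF : scale c F = (1 + T) * F) (hG : scale c G = (1 + T) * G)
    (h0 : scale 0 F = scale 0 G) : F = G := by
  have hcoeff : ∀ {H : QuantumPlane γ}, scale 0 H = 0 → ∀ b, coeff (0, b) H = 0 := by
    intro H hH b
    have := congrArg (coeff (0, b)) hH
    simpa [coeff_scale] using this
  rw [← sub_eq_zero]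
  have hD0 : scale 0 (F - G) = 0 := by rw [map_sub, h0, sub_self]
  have hD : scale c (F - G) = (F - G) + T * (F - G) := by
    rw [map_sub, hF, hG]
    noncomm_ring
  generalize F - G = D at hD0 hD
  have key : ∀ a b, coeff (a, b) D = 0 := by
    intro a
    induction a using Nat.strong_induction_on with
    | _ a ih =>
      intro b
      rcases Nat.eq_zero_or_pos a with rfl | ha
      · exact hcoeff hD0 b
      have hTD : coeff (a, b) (T * D) = 0 := by
        rw [coeff_mul]
        refine Finset.sum_eq_zero fun i hi => Finset.sum_eq_zero fun j _ => ?_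
        rw [Finset.HasAntidiagonal.mem_antidiagonal] at hi
        rcases Nat.eq_zero_or_pos i.1 with h | h
        · rw [h, hcoeff hT, mul_zero, zero_mul]
        · rw [ih i.2 (by dsimp only at hi; omega), mul_zero]
      have h := congrArg (coeff (a, b)) hD
      rw [coeff_scale, map_add, hTD, add_zero] at h
      have h' : (c ^ a - 1) * coeff (a, b) D = 0 := by
        rw [sub_mul, one_mul, sub_eq_zero]
        exact h
      exact (mul_eq_zero.mp h').resolve_left (sub_ne_zero.mpr (hc a ha))
  ext ⟨a, b⟩
  rw [key, map_zero]

/-! ### The quantum dilogarithm -/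

/-- The quantum dilogarithm as an element of the ring `QuantumPlane γ`. -/
def psi (w : K) (Z : QuantumPlane γ) : QuantumPlane γ := qPsi γ w Z

lemma psi_eq_qeval (hZ : coeff (0, 0) Z = 0) (w : K) :
    psi w Z = qeval (PowerSeries.qdilog w) Z := qPsi_eq_qeval hZ w

lemma coeff_smul_eq_zero (hZ : coeff (0, 0) Z = 0) (c : K) : coeff (0, 0) (c • Z) = 0 := by
  rw [map_smul, hZ, smul_zero]

lemma coeff_mul_eq_zero (F : QuantumPlane γ) (hZ : coeff (0, 0) Z = 0) :
    coeff (0, 0) (F * Z) = 0 := by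
  simp [coeff_mul, hZ]

lemma psi_zero (w : K) : psi w (0 : QuantumPlane γ) = 1 := by
  rw [psi_eq_qeval (map_zero _), ← zero_smul K (0 : QuantumPlane γ), qeval_smul,
    PowerSeries.rescale_zero, RingHom.comp_apply, PowerSeries.constantCoeff_qdilog, map_one,
    qeval_one (map_zero _)]

lemma scale_psi (hZ : coeff (0, 0) Z = 0) (c w : K) : scale c (psi w Z) = psi w (scale c Z) := by
  have h : coeff (0, 0) (scale c Z) = 0 := by rw [coeff_scale, hZ, mul_zero]
  rw [psi_eq_qeval hZ, psi_eq_qeval h, scale_qeval]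

lemma psi_eqUpTo_one {N : ℕ} (w : K) (hZ : EqUpTo N Z 0) : EqUpTo N (psi w Z) 1 := by
  have hZ0 : coeff (0, 0) Z = 0 := by rw [hZ (0, 0) (Nat.zero_le _), map_zero]
  intro p hp
  rw [psi_eq_qeval hZ0, coeff_qeval, Finset.sum_eq_single 0]
  · rw [PowerSeries.coeff_zero_eq_constantCoeff_apply, PowerSeries.constantCoeff_qdilog, pow_zero,
      one_mul]
  · intro k _ hk
    rw [hZ.pow k p hp, zero_pow hk, map_zero, mul_zero]
  · simp

section FourTerm

variable {w : K} (hw : w ≠ 0) (hw' : ∀ j : ℕ, 0 < j → w ^ j ≠ 1)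

include hw hw' in
lemma psi_sq_smul (hZ : coeff (0, 0) Z = 0) : psi w (w ^ 2 • Z) = (1 + w • Z) * psi w Z := by
  rw [psi_eq_qeval (coeff_smul_eq_zero hZ _), psi_eq_qeval hZ, qeval_smul,
    PowerSeries.rescale_sq_qdilog hw hw', qeval_mul hZ, qeval_one_add_smul_X hZ]

lemma mul_psi {T : QuantumPlane γ} {c : K} (hZ : coeff (0, 0) Z = 0) (h : T * Z = c • (Z * T)) :
    T * psi w Z = psi w (c • Z) * T := by
  rw [psi_eq_qeval (coeff_smul_eq_zero hZ _), psi_eq_qeval hZ, mul_qeval hZ h, qeval_smul]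

lemma psi_mul {T : QuantumPlane γ} {c : K} (hZ : coeff (0, 0) Z = 0) (h : Z * T = c • (T * Z)) :
    psi w Z * T = T * psi w (c • Z) := by
  rw [psi_eq_qeval (coeff_smul_eq_zero hZ _), psi_eq_qeval hZ, qeval_mul_comm hZ h, qeval_smul]

include hw hw' in
lemma psi_eq_mul (hZ : coeff (0, 0) Z = 0) :
    psi w Z = psi (w ^ 2) (w⁻¹ • Z) * psi (w ^ 2) (w • Z) := by
  rw [psi_eq_qeval (coeff_smul_eq_zero hZ _), psi_eq_qeval (coeff_smul_eq_zero hZ _),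
    psi_eq_qeval hZ, qeval_smul, qeval_smul, ← qeval_mul hZ, ← PowerSeries.qdilog_eq_mul hw hw']

include hw hw' in
lemma psi_eq_mul' (hZ : coeff (0, 0) Z = 0) :
    psi w Z = psi (w ^ 2) (w • Z) * psi (w ^ 2) (w⁻¹ • Z) := by
  rw [psi_eq_qeval (coeff_smul_eq_zero hZ _), psi_eq_qeval (coeff_smul_eq_zero hZ _),
    psi_eq_qeval hZ, qeval_smul, qeval_smul, ← qeval_mul hZ, mul_comm,
    ← PowerSeries.qdilog_eq_mul hw hw']

include hw hw' in
/-- The four-term relation of type `B₂` for quantum dilogarithms. -/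
lemma psi_four_term {U X B Y : QuantumPlane γ} (hU : coeff (0, 0) U = 0) (hX : coeff (0, 0) X = 0)
    (hUX : U * X = w ^ 4 • (X * U)) (hB : B = w ^ 2 • (X * U)) (hY : Y = w ^ 2 • (X * B))
    (hsU : ∀ c : K, scale c U = U) (hsX : ∀ c : K, scale c X = c • X) :
    psi (w ^ 2) U * psi w X = psi w X * psi (w ^ 2) Y * psi w B * psi (w ^ 2) U := by
  have hw2 : ∀ j : ℕ, 0 < j → (w ^ 2) ^ j ≠ 1 := fun j hj => by
    rw [← pow_mul]
    exact hw' _ (by omega)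
  have hw20 : w ^ 2 ≠ 0 := pow_ne_zero _ hw
  have hB0 : coeff (0, 0) B = 0 := by
    rw [hB]
    exact coeff_smul_eq_zero (coeff_mul_eq_zero _ hU) _
  have hY0 : coeff (0, 0) Y = 0 := by
    rw [hY]
    exact coeff_smul_eq_zero (coeff_mul_eq_zero _ hB0) _
  have hsB : ∀ c : K, scale c B = c • B := fun c => by
    rw [hB, scale_smul, map_mul, hsU, hsX, smul_mul_assoc, smul_comm]
  have hsY : ∀ c : K, scale c Y = c ^ 2 • Y := fun c => by
    rw [hY, scale_smul, map_mul, hsB, hsX, smul_mul_smul_comm, smul_comm, ← sq]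
  have hBX : B * X = w ^ 4 • (X * B) := by
    rw [hB, smul_mul_assoc, mul_assoc, hUX, mul_smul_comm, mul_smul_comm, smul_comm]
  have hBY : B * Y = (w ^ 2) ^ 2 • (Y * B) := by
    rw [hY, smul_mul_assoc, mul_smul_comm, ← mul_assoc, hBX, smul_mul_assoc, smul_comm, ← pow_mul]
  have huX : psi (w ^ 2) U * X = (X + B) * psi (w ^ 2) U := by
    rw [psi_mul hU hUX, show w ^ 4 = (w ^ 2) ^ 2 by ring, psi_sq_smul hw20 hw2 hU, ← mul_assoc,
      mul_add, mul_one, mul_smul_comm, ← hB]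
  have hXx : psi w X * X = X * psi w X := by
    simpa using psi_mul (w := w) (T := X) (c := 1) hX (by simp)
  have hBx : B * psi w X = (1 + w ^ 3 • X) * ((1 + w • X) * psi w X) * B := by
    rw [mul_psi hX hBX, show w ^ 4 = w ^ 2 * w ^ 2 by ring, mul_smul,
      psi_sq_smul hw hw' (coeff_smul_eq_zero hX _), psi_sq_smul hw hw' hX, smul_smul,
      show w * w ^ 2 = w ^ 3 by ring]
  have hBy : B * psi (w ^ 2) Y = (1 + w ^ 2 • Y) * psi (w ^ 2) Y * B := by
    rw [mul_psi hY0 hBY, psi_sq_smul hw20 hw2 hY0]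
  have key : (1 + w • X) * psi w X * ((1 + w ^ 2 • Y) * psi (w ^ 2) Y) * (1 + w • B) =
      (1 + w • (X + B)) * (psi w X * psi (w ^ 2) Y) := by
    have h1 : (1 + w • (X + B)) * (psi w X * psi (w ^ 2) Y) =
        (1 + w • X) * psi w X * psi (w ^ 2) Y + w • (B * psi w X) * psi (w ^ 2) Y := by
      simp only [smul_add, add_mul, one_mul, smul_mul_assoc, mul_assoc]
      abel
    have hXc : X * ((1 + w • X) * psi w X) = (1 + w • X) * psi w X * X := by
      simp only [add_mul, mul_add, one_mul, smul_mul_assoc, mul_smul_comm, mul_assoc, hXx]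
    have h2 : w • (B * psi w X) * psi (w ^ 2) Y =
        w • ((1 + w • X) * psi w X * (B * psi (w ^ 2) Y)) +
          (1 + w • X) * psi w X * (w ^ 2 • Y) * psi (w ^ 2) Y := by
      rw [hBx]
      generalize (1 + w • X) * psi w X = A at hXc ⊢
      rw [add_mul, one_mul, smul_mul_assoc (w ^ 3) X, hXc, hY]
      simp only [add_mul, smul_add, smul_mul_assoc, mul_smul_comm, mul_assoc, smul_smul]
      congr 2
      ring
    rw [h1, h2, hBy]
    generalize (1 + w • X) * psi w X = A
    simp only [add_mul, mul_add, one_mul, mul_one, smul_mul_assoc, mul_smul_comm, mul_assoc,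
      smul_add]
    abel
  refine eq_of_scale_eq (c := w ^ 2) hw2 (T := w • (X + B)) ?_ ?_ ?_ ?_
  · rw [scale_smul, map_add, hsX, hsB, zero_smul, zero_smul, add_zero, smul_zero]
  · rw [map_mul, scale_psi hU, scale_psi hX, hsU, hsX, psi_sq_smul hw hw' hX, ← mul_assoc,
      ← mul_assoc, mul_add, add_mul, mul_smul_comm, huX, mul_one]
    simp only [add_mul, one_mul, smul_mul_assoc]
  · rw [map_mul, map_mul, map_mul, scale_psi hU, scale_psi hX, scale_psi hY0, scale_psi hB0, hsU,
      hsX, hsY, hsB, psi_sq_smul hw hw' hX, psi_sq_smul hw20 hw2 hY0, psi_sq_smul hw hw' hB0,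
      ← mul_assoc _ (1 + w • B), key]
    simp only [mul_assoc]
  · rw [map_mul, map_mul, map_mul, map_mul, scale_psi hU, scale_psi hX, scale_psi hY0,
      scale_psi hB0, hsU, hsX, hsY, hsB, zero_smul, zero_smul, zero_pow two_ne_zero, zero_smul,
      psi_zero, psi_zero, mul_one, one_mul, one_mul, one_mul]

end FourTerm

/-! ### Specialisation to powers of `v` -/

lemma v_pow_ne_one {n : ℕ} (hn : 0 < n) : v ^ n ≠ 1 := by
  intro h
  rw [v, ← RatFunc.algebraMap_X, ← map_pow, ← map_one (algebraMap (Polynomial ℚ) (RatFunc ℚ))] at h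
  have h' := congrArg Polynomial.natDegree (RatFunc.algebraMap_injective ℚ h)
  rw [Polynomial.natDegree_X_pow, Polynomial.natDegree_one] at h'
  omega

lemma v_pow_pow_ne_one {n : ℕ} (hn : 0 < n) (j : ℕ) (hj : 0 < j) : (v ^ n) ^ j ≠ 1 := by
  rw [← pow_mul]
  exact v_pow_ne_one (Nat.mul_pos hn hj)

lemma inv_pow_smul_mon (t : ℕ) (β : ℤ) (m n : ℕ) :
    (v ^ t)⁻¹ • (mon β m n : QuantumPlane γ) = mon (-t + β) m n := by
  rw [← zpow_natCast, ← zpow_neg, zpow_smul_mon]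

lemma coeff_zero_mon {β : ℤ} {m n : ℕ} (h : 0 < m + n) :
    coeff (0, 0) (mon β m n : QuantumPlane γ) = 0 :=
  coeff_mon_eq_zero h

lemma psi_mon_eqUpTo_one (w : K) {β : ℤ} {m n N : ℕ} (h : N < m + n) :
    EqUpTo N (psi w (mon β m n : QuantumPlane γ)) 1 :=
  psi_eqUpTo_one w fun p hp => by rw [coeff_mon_eq_zero (by omega), map_zero]

/-- The two halves of `Ψ_{v^f}` commute, so the sign `ε` can be chosen freely. -/
lemma psi_mon_mul_psi_mon {f : ℕ} (hf : 0 < f) {ε : ℤ} (hε : ε = 1 ∨ ε = -1) (e : ℤ) {m n : ℕ}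
    (h : 0 < m + n) :
    psi (v ^ (2 * f)) (mon (e - ε * f) m n) * psi (v ^ (2 * f)) (mon (e + ε * f) m n) =
      (psi (v ^ f) (mon e m n) : QuantumPlane γ) := by
  have hv : v ^ f ≠ 0 := pow_ne_zero _ v_ne_zero
  have hv' := v_pow_pow_ne_one hf
  have hsq : v ^ (2 * f) = (v ^ f) ^ 2 := by rw [← pow_mul, mul_comm]
  rcases hε with rfl | rfl
  · rw [psi_eq_mul hv hv' (coeff_zero_mon h), inv_pow_smul_mon, pow_smul_mon, hsq]
    congr 3 <;> ring
  · rw [psi_eq_mul' hv hv' (coeff_zero_mon h), inv_pow_smul_mon, pow_smul_mon, hsq]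
    congr 3 <;> ring

lemma psi_mon_four_term {f : ℕ} (hf : 0 < f) (b β' : ℤ) (p : ℕ) :
    (psi (v ^ (4 * f)) (mon β' 0 1) * psi (v ^ (2 * f)) (mon b 1 p) : QuantumPlane (4 * f)) =
      psi (v ^ (2 * f)) (mon b 1 p) * psi (v ^ (4 * f)) (mon (2 * b + β') 2 (2 * p + 1)) *
        psi (v ^ (2 * f)) (mon (b + β') 1 (p + 1)) * psi (v ^ (4 * f)) (mon β' 0 1) := by
  have hsq : v ^ (4 * f) = (v ^ (2 * f)) ^ 2 := by rw [← pow_mul]; congr 1; ring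
  rw [hsq]
  refine psi_four_term (pow_ne_zero _ v_ne_zero) (v_pow_pow_ne_one (by omega))
    (coeff_zero_mon (by omega)) (coeff_zero_mon (by omega)) ?_ ?_ ?_ (fun c => ?_) fun c => ?_
  · rw [mon_mul_mon, mon_mul_mon, ← pow_mul, pow_smul_mon]
    congr 1
    · push_cast
      ring
    · ring
  · rw [mon_mul_mon, ← pow_mul, pow_smul_mon]
    congr 1
    push_cast
    ring
  · rw [mon_mul_mon, ← pow_mul, pow_smul_mon]
    congr 1
    · push_cast
      ring
    · ring
  · rw [scale_mon, pow_zero, one_smul]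
  · rw [scale_mon, pow_one]

/-! ### Ordered products -/

/-- The ordered product `g a * g (a + 1) * ⋯ * g b`. -/
def prodR (g : ℕ → QuantumPlane γ) (a b : ℕ) : QuantumPlane γ :=
  ((List.range' a (b + 1 - a)).map g).prod

/-- The ordered product `g b * ⋯ * g (a + 1) * g a`. -/
def prodL (g : ℕ → QuantumPlane γ) (a b : ℕ) : QuantumPlane γ :=
  ((List.range' a (b + 1 - a)).reverse.map g).prod

lemma qprodR_eq_prodR (g : ℕ → QuantumPlane γ) (a b : ℕ) : qprodR γ g a b = prodR g a b := by
  unfold qprodR prodR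
  induction List.range' a (b + 1 - a) with
  | nil => rfl
  | cons x l ih => exact congrArg (qmul γ (g x)) ih

lemma qprodL_eq_prodL (g : ℕ → QuantumPlane γ) (a b : ℕ) : qprodL γ g a b = prodL g a b := by
  unfold qprodL prodL
  induction (List.range' a (b + 1 - a)).reverse with
  | nil => rfl
  | cons x l ih => exact congrArg (qmul γ (g x)) ih

lemma prodR_succ (g : ℕ → QuantumPlane γ) {a N : ℕ} (h : a ≤ N + 1) :
    prodR g a (N + 1) = prodR g a N * g (N + 1) := by
  rw [prodR, prodR, show N + 1 + 1 - a = (N + 1 - a) + 1 by omega, List.range'_concat,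
    List.map_append, List.prod_append]
  simp [show a + (N + 1 - a) = N + 1 by omega]

/-- The partial products of the two sides of the first identity, up to a tail factor. -/
lemma psi_mul_prodR {f : ℕ} (hf : 0 < f) (β β' : ℤ) {ε : ℤ} (hε : ε = 1 ∨ ε = -1) (N : ℕ) :
    (psi (v ^ (4 * f)) (mon β' 0 1) *
        prodR (fun p => psi (v ^ (2 * f)) (mon (β + p * β' + 2 * p * ε * f) 1 p)) 0 N :
          QuantumPlane (4 * f)) =
      psi (v ^ (2 * f)) (mon β 1 0) *
        (prodR (fun p => psi (v ^ (4 * f))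
            (mon (2 * β + (2 * p - 1) * β' + 4 * (p - 1) * ε * f) 2 (2 * p - 1)) *
              psi (v ^ f) (mon (β + p * β' + (2 * p - 1) * ε * f) 1 p)) 1 N *
          (psi (v ^ (4 * f)) (mon (2 * (β + N * β' + 2 * N * ε * f) + β') 2 (2 * N + 1)) *
            psi (v ^ (2 * f)) (mon (β + N * β' + 2 * N * ε * f + β') 1 (N + 1))) *
          psi (v ^ (4 * f)) (mon β' 0 1)) := by
  induction N with
  | zero =>
    have h := psi_mon_four_term hf β β' 0
    simp only [prodR]
    simpa [mul_assoc] using h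
  | succ N ih =>
    have h4 := psi_mon_four_term hf (β + (N + 1 : ℕ) * β' + 2 * (N + 1 : ℕ) * ε * f) β' (N + 1)
    have h2 := psi_mon_mul_psi_mon (γ := 4 * f) hf hε
      (β + (N + 1 : ℕ) * β' + (2 * (N + 1 : ℕ) - 1) * ε * f) (m := 1) (n := N + 1) (by omega)
    rw [show (β + (N + 1 : ℕ) * β' + (2 * (N + 1 : ℕ) - 1) * ε * f - ε * f : ℤ) =
        β + N * β' + 2 * N * ε * f + β' by push_cast; ring,
      show (β + (N + 1 : ℕ) * β' + (2 * (N + 1 : ℕ) - 1) * ε * f + ε * f : ℤ) =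
        β + (N + 1 : ℕ) * β' + 2 * (N + 1 : ℕ) * ε * f by push_cast; ring] at h2
    have hY : (2 * β + (2 * (N + 1 : ℕ) - 1) * β' + 4 * ((N + 1 : ℕ) - 1) * ε * f : ℤ) =
        2 * (β + N * β' + 2 * N * ε * f) + β' := by push_cast; ring
    rw [prodR_succ _ (Nat.zero_le _), prodR_succ _ (by omega), ← mul_assoc, ih, ← h2, hY,
      show 2 * (N + 1) - 1 = 2 * N + 1 by omega]
    simp only [mul_assoc (G := QuantumPlane (4 * f))]
    rw [h4]
    simp only [mul_assoc (G := QuantumPlane (4 * f))]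

/-- The first identity, as a statement about the ring of the quantum plane. -/
lemma exists_limit_prodR {f : ℕ} (hf : 0 < f) (β β' : ℤ) {ε : ℤ} (hε : ε = 1 ∨ ε = -1) :
    ∃ L : QuantumPlane (4 * f),
      (∀ x, ∀ᶠ N in atTop, coeff (γ := 4 * f) x (psi (v ^ (4 * f)) (mon β' 0 1) *
        prodR (fun p => psi (v ^ (2 * f)) (mon (β + p * β' + 2 * p * ε * f) 1 p)) 0 N) =
          coeff x L) ∧
      (∀ x, ∀ᶠ N in atTop, coeff (γ := 4 * f) x (psi (v ^ (2 * f)) (mon β 1 0) *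
        (prodR (fun p => psi (v ^ (4 * f))
            (mon (2 * β + (2 * p - 1) * β' + 4 * (p - 1) * ε * f) 2 (2 * p - 1)) *
              psi (v ^ f) (mon (β + p * β' + (2 * p - 1) * ε * f) 1 p)) 1 N *
          psi (v ^ (4 * f)) (mon β' 0 1))) = coeff x L) := by
  have hpsi := psi_mul_prodR hf β β' hε
  set lhs : ℕ → QuantumPlane (4 * f) := fun N => psi (v ^ (4 * f)) (mon β' 0 1) *
    prodR (fun p => psi (v ^ (2 * f)) (mon (β + p * β' + 2 * p * ε * f) 1 p)) 0 N with hlhs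
  have hstep : ∀ N, EqUpTo N (lhs (N + 1)) (lhs N) := by
    intro N
    simp only [hlhs]
    rw [prodR_succ _ (Nat.zero_le _), ← mul_assoc]
    simpa only [mul_one] using (EqUpTo.refl _).mul (psi_mon_eqUpTo_one (v ^ (2 * f))
      (β := β + (N + 1 : ℕ) * β' + 2 * (N + 1 : ℕ) * ε * f) (show N < 1 + (N + 1) by omega))
  have hstable : ∀ {x : ℕ × ℕ} {N : ℕ}, x.1 + x.2 ≤ N →
      coeff x (lhs N) = coeff x (lhs (x.1 + x.2)) := by
    intro x N hN
    induction N, hN using Nat.le_induction with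
    | base => rfl
    | succ N hN ih => rw [hstep N x hN, ih]
  refine ⟨fun x => coeff x (lhs (x.1 + x.2)), fun x => ?_, fun x => ?_⟩
  · filter_upwards [eventually_ge_atTop (x.1 + x.2)] with N hN
    exact hstable hN
  · filter_upwards [eventually_ge_atTop (x.1 + x.2)] with N hN
    refine Eq.trans ?_ (hstable hN)
    rw [show lhs N = _ from hpsi N]
    refine EqUpTo.mul (EqUpTo.refl _) (EqUpTo.mul ?_ (EqUpTo.refl _)) x hN
    have h := ((psi_mon_eqUpTo_one (γ := 4 * f) (v ^ (4 * f))
      (β := 2 * (β + N * β' + 2 * N * ε * f) + β') (show N < 2 + (2 * N + 1) by omega)).mul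
        (psi_mon_eqUpTo_one (v ^ (2 * f)) (β := β + N * β' + 2 * N * ε * f + β')
          (show N < 1 + (N + 1) by omega))).symm
    simpa only [mul_one] using (EqUpTo.refl _).mul h

/-! ### Exchanging the two variables -/

/-- The anti-automorphism exchanging `Y₁` and `Y₂`. -/
def swap (F : QuantumPlane γ) : QuantumPlane γ := fun p => coeff p.swap F

lemma coeff_swap (F : QuantumPlane γ) (p : ℕ × ℕ) : coeff p (swap F) = coeff p.swap F := rfl

lemma swap_one : swap (1 : QuantumPlane γ) = 1 := by
  ext ⟨a, b⟩
  simp [coeff_swap, coeff_one, and_comm]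

lemma swap_mul (F G : QuantumPlane γ) : swap (F * G) = swap G * swap F := by
  ext ⟨a, b⟩
  rw [coeff_swap, coeff_mul, coeff_mul, Finset.sum_comm, ← Finset.Nat.sum_antidiagonal_swap]
  refine Finset.sum_congr rfl fun i _ => ?_
  rw [← Finset.Nat.sum_antidiagonal_swap]
  refine Finset.sum_congr rfl fun j _ => ?_
  simp only [coeff_swap, Prod.fst_swap, Prod.snd_swap, Prod.swap_prod_mk]
  ring

lemma swap_mon (β : ℤ) (m n : ℕ) : swap (mon β m n : QuantumPlane γ) = mon β n m := by
  ext ⟨a, b⟩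
  rw [coeff_swap, coeff_mon, coeff_mon]
  simp only [Prod.swap_prod_mk, Prod.mk.injEq, and_comm, mul_right_comm]

lemma swap_pow (F : QuantumPlane γ) (k : ℕ) : swap (F ^ k) = swap F ^ k := by
  induction k with
  | zero => rw [pow_zero, pow_zero, swap_one]
  | succ k ih => rw [pow_succ, pow_succ', swap_mul, ih]

lemma swap_psi (hZ : coeff (0, 0) Z = 0) (w : K) : swap (psi w Z) = psi w (swap Z) := by
  have h : coeff (0, 0) (swap Z) = 0 := hZ
  rw [psi_eq_qeval hZ, psi_eq_qeval h]
  ext p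
  rw [coeff_swap, coeff_qeval, coeff_qeval, Prod.fst_swap, Prod.snd_swap, add_comm p.2]
  simp only [← swap_pow, coeff_swap]

lemma swap_psi_mon (w : K) (β : ℤ) {m n : ℕ} (h : 0 < m + n) :
    swap (psi w (mon β m n : QuantumPlane γ)) = psi w (mon β n m) := by
  rw [swap_psi (coeff_zero_mon h), swap_mon]

lemma swap_prodR {g g' : ℕ → QuantumPlane γ} {a : ℕ} (h : ∀ p, a ≤ p → swap (g p) = g' p)
    (b : ℕ) : swap (prodR g a b) = prodL g' a b := by
  have key : ∀ l : List ℕ, (∀ p ∈ l, a ≤ p) →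
      swap (l.map g).prod = (l.reverse.map g').prod := by
    intro l
    induction l with
    | nil => exact fun _ => swap_one
    | cons x l ih =>
      intro hl
      rw [List.map_cons, List.prod_cons, swap_mul, ih fun p hp => hl p (List.mem_cons_of_mem _ hp),
        h x (hl x List.mem_cons_self), List.reverse_cons, List.map_append, List.prod_append]
      simp
  exact key _ fun p hp => (List.mem_range'_1.mp hp).1

/-- The second identity, as a statement about the ring of the quantum plane. -/
lemma exists_limit_prodL {f : ℕ} (hf : 0 < f) (β β' : ℤ) {ε : ℤ} (hε : ε = 1 ∨ ε = -1) :
    ∃ L : QuantumPlane (4 * f),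
      (∀ x, ∀ᶠ N in atTop, coeff (γ := 4 * f) x (
        prodL (fun p => psi (v ^ (2 * f)) (mon (p * β + β' + 2 * p * ε * f) p 1)) 0 N *
          psi (v ^ (4 * f)) (mon β 1 0)) = coeff x L) ∧
      (∀ x, ∀ᶠ N in atTop, coeff (γ := 4 * f) x (psi (v ^ (4 * f)) (mon β 1 0) *
        (prodL (fun p => psi (v ^ f) (mon (p * β + β' + (2 * p - 1) * ε * f) p 1) *
          psi (v ^ (4 * f))
            (mon ((2 * p - 1) * β + 2 * β' + 4 * (p - 1) * ε * f) (2 * p - 1) 2)) 1 N *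
          psi (v ^ (2 * f)) (mon β' 0 1))) = coeff x L) := by
  obtain ⟨L, h1, h2⟩ := exists_limit_prodR hf β' β hε
  refine ⟨swap L, fun x => (h1 x.swap).mono fun N h => ?_, fun x => (h2 x.swap).mono fun N h => ?_⟩
  · rw [← coeff_swap, swap_mul, swap_psi_mon _ _ (by omega), ← coeff_swap] at h
    rw [← h, swap_prodR]
    intro p _
    rw [swap_psi_mon _ _ (by omega), add_comm β']
  · rw [← coeff_swap, swap_mul, swap_mul, swap_psi_mon _ _ (by omega),
      swap_psi_mon _ _ (by omega), ← coeff_swap, mul_assoc] at h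
    rw [← h, swap_prodR]
    intro p _
    rw [swap_mul, swap_psi_mon _ _ (by omega), swap_psi_mon _ _ (by omega), add_comm β',
      add_comm (2 * β')]

end QuantumPlane

/-- Lemma A.6, quantum-plane form: in `A_{4f}`, for `ε = ±1`,
(i) `Ψ_{v^{4f}}(v^{β'}Y₂)·→∏_{p≥0} Ψ_{v^{2f}}(v^{β+pβ'+2pεf}y^{(1,p)})
  = Ψ_{v^{2f}}(v^{β}Y₁)·
    (→∏_{p≥1} [Ψ_{v^{4f}}(v^{2β+(2p−1)β'+4(p−1)εf}y^{(2,2p−1)})·Ψ_{v^f}(v^{β+pβ'+(2p−1)εf}y^{(1,p)})])·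
    Ψ_{v^{4f}}(v^{β'}Y₂)`, and
(ii) `(←∏_{p≥0} Ψ_{v^{2f}}(v^{pβ+β'+2pεf}y^{(p,1)}))·Ψ_{v^{4f}}(v^{β}Y₁)
  = Ψ_{v^{4f}}(v^{β}Y₁)·
    (←∏_{p≥1} [Ψ_{v^f}(v^{pβ+β'+(2p−1)εf}y^{(p,1)})·Ψ_{v^{4f}}(v^{(2p−1)β+2β'+4(p−1)εf}y^{(2p−1,2)})])·
    Ψ_{v^{2f}}(v^{β'}Y₂)`,
both sides understood as coefficientwise limits of the partial ordered products. -/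
theorem lemma_A6 (f : ℕ) (hf : 0 < f) (β β' ε : ℤ) (hε : ε = 1 ∨ ε = -1) :
    (∃ L : QP,
      (∀ x, ∀ᶠ N in atTop,
        qmul (4 * f) (qPsi (4 * f) (v ^ (4 * f)) (qy (4 * f) β' 0 1))
          (qprodR (4 * f)
            (fun p => qPsi (4 * f) (v ^ (2 * f))
              (qy (4 * f) (β + (p : ℤ) * β' + 2 * (p : ℤ) * ε * (f : ℤ)) 1 p)) 0 N) x = L x) ∧
      (∀ x, ∀ᶠ N in atTop,
        qmul (4 * f) (qPsi (4 * f) (v ^ (2 * f)) (qy (4 * f) β 1 0))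
          (qmul (4 * f)
            (qprodR (4 * f)
              (fun p => qmul (4 * f)
                (qPsi (4 * f) (v ^ (4 * f))
                  (qy (4 * f)
                    (2 * β + (2 * (p : ℤ) - 1) * β' + 4 * ((p : ℤ) - 1) * ε * (f : ℤ)) 2 (2 * p - 1)))
                (qPsi (4 * f) (v ^ f)
                  (qy (4 * f) (β + (p : ℤ) * β' + (2 * (p : ℤ) - 1) * ε * (f : ℤ)) 1 p))) 1 N)
            (qPsi (4 * f) (v ^ (4 * f)) (qy (4 * f) β' 0 1))) x = L x))
    ∧
    (∃ L : QP,
      (∀ x, ∀ᶠ N in atTop,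
        qmul (4 * f)
          (qprodL (4 * f)
            (fun p => qPsi (4 * f) (v ^ (2 * f))
              (qy (4 * f) ((p : ℤ) * β + β' + 2 * (p : ℤ) * ε * (f : ℤ)) p 1)) 0 N)
          (qPsi (4 * f) (v ^ (4 * f)) (qy (4 * f) β 1 0)) x = L x) ∧
      (∀ x, ∀ᶠ N in atTop,
        qmul (4 * f) (qPsi (4 * f) (v ^ (4 * f)) (qy (4 * f) β 1 0))
          (qmul (4 * f)
            (qprodL (4 * f)
              (fun p => qmul (4 * f)
                (qPsi (4 * f) (v ^ f)
                  (qy (4 * f) ((p : ℤ) * β + β' + (2 * (p : ℤ) - 1) * ε * (f : ℤ)) p 1))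
                (qPsi (4 * f) (v ^ (4 * f))
                  (qy (4 * f)
                    ((2 * (p : ℤ) - 1) * β + 2 * β' + 4 * ((p : ℤ) - 1) * ε * (f : ℤ))
                    (2 * p - 1) 2))) 1 N)
            (qPsi (4 * f) (v ^ (2 * f)) (qy (4 * f) β' 0 1))) x = L x)) := by
  constructor
  · obtain ⟨L, h1, h2⟩ := QuantumPlane.exists_limit_prodR hf β β' hε
    refine ⟨L, fun x => (h1 x).mono fun N h => ?_, fun x => (h2 x).mono fun N h => ?_⟩
    · rw [← QuantumPlane.qprodR_eq_prodR] at h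
      exact h
    · rw [← QuantumPlane.qprodR_eq_prodR] at h
      exact h
  · obtain ⟨L, h1, h2⟩ := QuantumPlane.exists_limit_prodL hf β β' hε
    refine ⟨L, fun x => (h1 x).mono fun N h => ?_, fun x => (h2 x).mono fun N h => ?_⟩
    · rw [← QuantumPlane.qprodL_eq_prodL] at h
      exact h
    · rw [← QuantumPlane.qprodL_eq_prodL] at h
      exact h
end
end

section
/- (Theorem A.7: ordered product expansion of affine type A₂⁽²⁾, quantum-plane form.) Let f be a positive integer and β, β' integers. In the completed quantum plane A_{4f} (so Y₂Y₁ = v^{8f}·Y₁Y₂), the identity Ψ_{v^{f}}(v^{β'}·Y₂) · Ψ_{v^{4f}}(v^{β}·Y₁) = (→∏_{p≥0} [Ψ_{v^{4f}}(v^{(2p+1)β+4pβ'}·y^{(2p+1,4p)}) · Ψ_{v^{f}}(v^{(p+1)β+(2p+1)β'}·y^{(p+1,2p+1)})]) · Ψ_{v^{2f}}(v^{β+2β'}·y^{(1,2)}) · (∏_{p≥0} Ψ_{v^{2^{p+1}f}}(v^{2^p(β+2β')−2^{p+1}f}·y^{(2^p,2^{p+1})}) · Ψ_{v^{2^{p+1}f}}(v^{2^p(β+2β')+2^{p+1}f}·y^{(2^p,2^{p+1})}))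 · (←∏_{p≥0} [Ψ_{v^{4f}}(v^{(2p+1)β+(4p+4)β'}·y^{(2p+1,4p+4)}) · Ψ_{v^{f}}(v^{pβ+(2p+1)β'}·y^{(p,2p+1)})]) holds, where all infinite ordered products are coefficientwise limits of partial ordered products (the factors in the middle family pairwise commute). In particular, for f = 1 and β = β' = 0 this is the consistency relation of the rank-2 quantum cluster scattering diagram of affine type A₂⁽²⁾ with (δ₁,δ₂) = (1,4). -/
noncomputable section

open Filter

/-- The product `g 0 * g 1 * ⋯ * g (n - 1)` in a monoid. -/
def fwdProd {M : Type*} [Monoid M] (g : ℕ → M) (n : ℕ) : M := ((List.range n).map g).prod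

/-- The product `g (n - 1) * ⋯ * g 1 * g 0` in a monoid. -/
def bwdProd {M : Type*} [Monoid M] (g : ℕ → M) (n : ℕ) : M := ((List.range n).reverse.map g).prod

section OrderedProducts

variable {M : Type*} [Monoid M]

@[simp] lemma fwdProd_zero (g : ℕ → M) : fwdProd g 0 = 1 := by simp [fwdProd]

@[simp] lemma bwdProd_zero (g : ℕ → M) : bwdProd g 0 = 1 := by simp [bwdProd]

lemma fwdProd_succ (g : ℕ → M) (n : ℕ) : fwdProd g (n + 1) = fwdProd g n * g n := by
  simp [fwdProd, List.range_succ]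

lemma bwdProd_succ (g : ℕ → M) (n : ℕ) : bwdProd g (n + 1) = g n * bwdProd g n := by
  simp [bwdProd, List.range_succ]

lemma fwdProd_succ' (g : ℕ → M) (n : ℕ) :
    fwdProd g (n + 1) = g 0 * fwdProd (fun k => g (k + 1)) n := by
  induction n with
  | zero => simp [fwdProd_succ]
  | succ n ih => rw [fwdProd_succ, ih, fwdProd_succ, mul_assoc]

lemma fwdProd_congr {g h : ℕ → M} (H : ∀ k, g k = h k) (n : ℕ) : fwdProd g n = fwdProd h n := by
  rw [funext H]

lemma bwdProd_congr {g h : ℕ → M} (H : ∀ k, g k = h k) (n : ℕ) : bwdProd g n = bwdProd h n := by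
  rw [funext H]

lemma fwdProd_add_of_eq_one {g : ℕ → M} {n : ℕ} (H : ∀ k, n ≤ k → g k = 1) (j : ℕ) :
    fwdProd g (n + j) = fwdProd g n := by
  induction j with
  | zero => rfl
  | succ j ih => rw [← add_assoc, fwdProd_succ, ih, H _ (by omega), mul_one]

lemma bwdProd_add_of_eq_one {g : ℕ → M} {n : ℕ} (H : ∀ k, n ≤ k → g k = 1) (j : ℕ) :
    bwdProd g (n + j) = bwdProd g n := by
  induction j with
  | zero => rfl
  | succ j ih => rw [← add_assoc, bwdProd_succ, ih, H _ (by omega), one_mul]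

lemma commute_fwdProd {x : M} {g : ℕ → M} (H : ∀ k, Commute x (g k)) (n : ℕ) :
    Commute x (fwdProd g n) := by
  induction n with
  | zero => simp
  | succ n ih => rw [fwdProd_succ]; exact ih.mul_right (H n)

lemma map_fwdProd {M' Φ : Type*} [Monoid M'] [FunLike Φ M M'] [MonoidHomClass Φ M M'] (φ : Φ)
    (g : ℕ → M) (n : ℕ) :
    φ (fwdProd g n) = fwdProd (fun k => φ (g k)) n := by
  simp [fwdProd, map_list_prod, Function.comp_def]

lemma map_bwdProd {M' Φ : Type*} [Monoid M'] [FunLike Φ M M'] [MonoidHomClass Φ M M'] (φ : Φ)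
    (g : ℕ → M) (n : ℕ) :
    φ (bwdProd g n) = bwdProd (fun k => φ (g k)) n := by
  simp [bwdProd, map_list_prod, Function.comp_def]

end OrderedProducts

/-- A family `P e s m n` in a monoid, modelling `Ψ_{v^e}(v^s·y^{(m,n)})` in `A_γ` modulo total
degree `d`, that satisfies the fission and pentagon relations. -/
structure PsiSystem (γ d : ℕ) (M : Type*) [Monoid M] where
  P : ℕ → ℤ → ℕ → ℕ → M
  fission : ∀ {e : ℕ} (s : ℤ) {m n : ℕ}, 0 < e → 0 < m + n →
    P e s m n = P (2 * e) (s + e) m n * P (2 * e) (s - e) m n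
  pentagon : ∀ {e : ℕ} (s t : ℤ) {m n m' n' : ℕ}, 0 < e →
    (γ : ℤ) * (n * m' - m * n') = e →
    P e s m n * P e t m' n' = P e t m' n' * P e (s + t) (m + m') (n + n') * P e s m n
  commute : ∀ (e e' : ℕ) (s t : ℤ) {m n m' n' : ℕ}, n * m' = m * n' →
    Commute (P e s m n) (P e' t m' n')
  vanish : ∀ (e : ℕ) (s : ℤ) {m n : ℕ}, d ≤ m + n → P e s m n = 1

namespace PsiSystem

variable {γ d : ℕ} {M : Type*} [Monoid M] (S : PsiSystem γ d M)

lemma congr {e e' : ℕ} {s s' : ℤ} {m m' n n' : ℕ} (he : e = e') (hs : s = s') (hm : m = m')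
    (hn : n = n') : S.P e s m n = S.P e' s' m' n' := by
  subst he hs hm hn; rfl

lemma pos_left_of_det {e : ℕ} {m n m' n' : ℕ} (he : 0 < e)
    (h : (γ : ℤ) * (n * m' - m * n') = e) : 0 < m + n := by
  by_contra h0
  obtain ⟨rfl, rfl⟩ : m = 0 ∧ n = 0 := by omega
  simp at h; omega

lemma pos_right_of_det {e : ℕ} {m n m' n' : ℕ} (he : 0 < e)
    (h : (γ : ℤ) * (n * m' - m * n') = e) : 0 < m' + n' := by
  by_contra h0
  obtain ⟨rfl, rfl⟩ : m' = 0 ∧ n' = 0 := by omega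
  simp at h; omega

/-- The `B₂` relation whose left factor has the larger label. -/
lemma exchange_long_short {e : ℕ} (s t : ℤ) {m n m' n' : ℕ} (he : 0 < e)
    (h : (γ : ℤ) * (n * m' - m * n') = (2 * e : ℕ)) :
    S.P (2 * e) s m n * S.P e t m' n' =
      S.P e t m' n' * S.P (2 * e) (s + 2 * t) (m + 2 * m') (n + 2 * n') *
        S.P e (s + t) (m + m') (n + n') * S.P (2 * e) s m n := by
  have h2 : 0 < 2 * e := by omega
  have hw := pos_right_of_det h2 h
  have h' : (γ : ℤ) * ((n + n' : ℕ) * m' - (m + m' : ℕ) * n') = (2 * e : ℕ) := by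
    rw [← h]; push_cast; ring
  have k1 := S.pentagon s (t + e) h2 h
  have k2 := S.pentagon s (t - e) h2 h
  have k3 := S.pentagon (s + (t + e)) (t - e) h2 h'
  rw [S.fission t he hw, S.fission (s + t) he (show 0 < (m + m') + (n + n') by omega)]
  rw [← mul_assoc, k1, mul_assoc, k2, ← mul_assoc, ← mul_assoc,
    mul_assoc (S.P (2 * e) (t + e) m' n'), k3]
  have e1 : s + (t + e) + (t - e) = s + 2 * t := by ring
  have e2 : s + (t + e) = s + t + e := by ring
  have e3 : s + (t - e) = s + t - e := by ring
  have e4 : m + m' + m' = m + 2 * m' := by ring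
  have e5 : n + n' + n' = n + 2 * n' := by ring
  rw [e1, e2, e3, e4, e5]
  simp only [mul_assoc]

/-- The `B₂` relation whose right factor has the larger label. -/
lemma exchange_short_long {e : ℕ} (s t : ℤ) {m n m' n' : ℕ} (he : 0 < e)
    (h : (γ : ℤ) * (n * m' - m * n') = (2 * e : ℕ)) :
    S.P e s m n * S.P (2 * e) t m' n' =
      S.P (2 * e) t m' n' * S.P e (s + t) (m + m') (n + n') *
        S.P (2 * e) (2 * s + t) (2 * m + m') (2 * n + n') * S.P e s m n := by
  have h2 : 0 < 2 * e := by omega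
  have hu := pos_left_of_det h2 h
  have h' : (γ : ℤ) * (n * (m + m' : ℕ) - m * (n + n' : ℕ)) = (2 * e : ℕ) := by
    rw [← h]; push_cast; ring
  have k1 := S.pentagon (s - e) t h2 h
  have k2 := S.pentagon (s + e) t h2 h
  have k3 := S.pentagon (s + e) ((s - e) + t) h2 h'
  rw [S.fission s he hu, S.fission (s + t) he (show 0 < (m + m') + (n + n') by omega)]
  rw [mul_assoc, k1, ← mul_assoc, ← mul_assoc, k2, mul_assoc (_ * _) (S.P (2 * e) (s + e) m n), k3]
  have e1 : s + e + (s - e + t) = 2 * s + t := by ring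
  have e2 : s + e + t = s + t + e := by ring
  have e3 : s - e + t = s + t - e := by ring
  have e4 : m + (m + m') = 2 * m + m' := by ring
  have e5 : n + (n + n') = 2 * n + n' := by ring
  rw [e1, e2, e3, e4, e5]
  simp only [mul_assoc]

/-- The `p`-th imaginary factor in the expansion of affine type `A₁⁽¹⁾`. -/
def imag (e : ℕ) (r : ℤ) (m n : ℕ) (p : ℕ) : M :=
  S.P (2 ^ p * e) (2 ^ p * r - 2 ^ p * e) (2 ^ p * m) (2 ^ p * n) *
    S.P (2 ^ p * e) (2 ^ p * r + 2 ^ p * e) (2 ^ p * m) (2 ^ p * n)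

/-- The `k`-th real factor, along the ray spanned by `k·(m,n) + (k+1)·(m',n')`. -/
def real (e : ℕ) (s t : ℤ) (m n m' n' : ℕ) (k : ℕ) : M :=
  S.P e (k * s + (k + 1) * t) (k * m + (k + 1) * m') (k * n + (k + 1) * n')

lemma real_eq_one (e : ℕ) (s t : ℤ) {m n m' n' k : ℕ} (h : 0 < m' + n') (hk : d ≤ k) :
    S.real e s t m n m' n' k = 1 := by
  apply S.vanish
  nlinarith [Nat.zero_le (k * m), Nat.zero_le (k * n)]

lemma imag_eq_one (e : ℕ) (r : ℤ) {m n p : ℕ} (h : 0 < m + n) (hp : d ≤ p) :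
    S.imag e r m n p = 1 := by
  have h1 : d ≤ 2 ^ p * m + 2 ^ p * n := by
    have := (Nat.lt_two_pow_self (n := p)).le
    nlinarith
  rw [imag, S.vanish _ _ h1, S.vanish _ _ h1, one_mul]

lemma commute_imag (e e' : ℕ) (r s : ℤ) {m n m' n' : ℕ} (p : ℕ) (h : n * m' = m * n') :
    Commute (S.P e s m n) (S.imag e' r m' n' p) := by
  have h1 : n * (2 ^ p * m') = m * (2 ^ p * n') := by linear_combination 2 ^ p * h
  exact (S.commute _ _ _ _ h1).mul_right (S.commute _ _ _ _ h1)

lemma sweep_right {e : ℕ} (s t : ℤ) {m n m' n' : ℕ} (he : 0 < e)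
    (h : (γ : ℤ) * (n * m' - m * n') = (2 * e : ℕ)) (N : ℕ) :
    S.P (2 * e) (t + e) m' n' * S.P e (s + t + e) (m + m') (n + n') *
      fwdProd (S.real (2 * e) (2 * s + t + e) (t - e) (2 * m + m') (2 * n + n') m' n') N =
    fwdProd (S.real e s t m n m' n') (2 * N) *
      S.P (2 * e) (2 * N * s + (2 * N + 1) * t + e) (2 * N * m + (2 * N + 1) * m')
        (2 * N * n + (2 * N + 1) * n') * S.P e (s + t + e) (m + m') (n + n') := by
  induction N with
  | zero => simp
  | succ N ih =>
    have hw := pos_right_of_det (by omega) h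
    rw [fwdProd_succ, ← mul_assoc, ih]
    have hx := S.exchange_short_long (s + t + e) (2 * N * s + (2 * N + 1) * t - e)
      (m := m + m') (n := n + n') (m' := 2 * N * m + (2 * N + 1) * m')
      (n' := 2 * N * n + (2 * N + 1) * n') he (by rw [← h]; push_cast; ring)
    have hf := S.fission (2 * N * s + (2 * N + 1) * t) (m := 2 * N * m + (2 * N + 1) * m')
      (n := 2 * N * n + (2 * N + 1) * n') he
      (by nlinarith [Nat.zero_le (2 * N * m), Nat.zero_le (2 * N * n)])
    have hr : S.real (2 * e) (2 * s + t + e) (t - e) (2 * m + m') (2 * n + n') m' n' N =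
        S.P (2 * e) (2 * N * s + (2 * N + 1) * t - e) (2 * N * m + (2 * N + 1) * m')
        (2 * N * n + (2 * N + 1) * n') := S.congr rfl (by ring) (by ring) (by ring)
    rw [hr, mul_assoc, hx, show 2 * (N + 1) = 2 * N + 1 + 1 by ring, fwdProd_succ, fwdProd_succ]
    have h1 : S.real e s t m n m' n' (2 * N) = S.P e (2 * N * s + (2 * N + 1) * t)
        (2 * N * m + (2 * N + 1) * m') (2 * N * n + (2 * N + 1) * n') :=
      S.congr rfl (by push_cast; ring) (by ring) (by ring)
    have h2 : S.real e s t m n m' n' (2 * N + 1) = S.P e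
        (s + t + e + (2 * N * s + (2 * N + 1) * t - e))
        (m + m' + (2 * N * m + (2 * N + 1) * m')) (n + n' + (2 * N * n + (2 * N + 1) * n')) :=
      S.congr rfl (by push_cast; ring) (by ring) (by ring)
    rw [h1, h2, hf]
    simp only [mul_assoc]
    congr 5
    exact S.congr rfl (by push_cast; ring) (by ring) (by ring)

lemma sweep_left {e : ℕ} (s t : ℤ) {m n m' n' : ℕ} (he : 0 < e)
    (h : (γ : ℤ) * (n * m' - m * n') = (2 * e : ℕ)) (N : ℕ) :
    bwdProd (S.real (2 * e) (t - e) (2 * s + t + e) m' n' (2 * m + m') (2 * n + n')) N *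
      S.P e (s + t - e) (m + m') (n + n') * S.P (2 * e) (2 * s + t - e) (2 * m + m') (2 * n + n') *
      S.P e s m n =
    S.P e (s + t - e) (m + m') (n + n') *
      S.P (2 * e) ((2 * N + 1) * t + (2 * N + 2) * s - e) ((2 * N + 1) * m' + (2 * N + 2) * m)
        ((2 * N + 1) * n' + (2 * N + 2) * n) *
      bwdProd (S.real e t s m' n' m n) (2 * N + 1) := by
  induction N with
  | zero =>
    simp only [bwdProd_zero, one_mul, mul_zero, zero_add, bwdProd_succ, mul_one]
    congr 1
    · congr 1
      exact S.congr rfl (by push_cast; ring) (by ring) (by ring)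
    · exact S.congr rfl (by push_cast; ring) (by ring) (by ring)
  | succ N ih =>
    have hu := pos_left_of_det (by omega) h
    rw [bwdProd_succ]
    simp only [mul_assoc] at ih ⊢
    rw [ih]
    have hr : S.real (2 * e) (t - e) (2 * s + t + e) m' n' (2 * m + m') (2 * n + n') N =
        S.P (2 * e) ((2 * N + 1) * t + (2 * N + 2) * s + e) ((2 * N + 1) * m' + (2 * N + 2) * m)
        ((2 * N + 1) * n' + (2 * N + 2) * n) := S.congr rfl (by ring) (by ring) (by ring)
    have hx := S.exchange_long_short ((2 * N + 1) * t + (2 * N + 2) * s + e) (s + t - e)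
      (m' := m + m') (n' := n + n') (m := (2 * N + 1) * m' + (2 * N + 2) * m)
      (n := (2 * N + 1) * n' + (2 * N + 2) * n) he (by rw [← h]; push_cast; ring)
    have hf := S.fission ((2 * N + 1) * t + (2 * N + 2) * s)
      (m := (2 * N + 1) * m' + (2 * N + 2) * m) (n := (2 * N + 1) * n' + (2 * N + 2) * n) he
      (by nlinarith [Nat.zero_le ((2 * N + 1) * m'), Nat.zero_le ((2 * N + 1) * n')])
    rw [hr, ← mul_assoc, hx, show 2 * (N + 1) + 1 = 2 * N + 1 + 1 + 1 by ring,
      bwdProd_succ _ (2 * N + 1 + 1),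
      bwdProd_succ _ (2 * N + 1)]
    have h1 : S.real e t s m' n' m n (2 * N + 1) = S.P e ((2 * N + 1) * t + (2 * N + 2) * s)
        ((2 * N + 1) * m' + (2 * N + 2) * m) ((2 * N + 1) * n' + (2 * N + 2) * n) :=
      S.congr rfl (by push_cast; ring) (by ring) (by ring)
    have h2 : S.real e t s m' n' m n (2 * N + 1 + 1) = S.P e
        ((2 * N + 1) * t + (2 * N + 2) * s + e + (s + t - e))
        ((2 * N + 1) * m' + (2 * N + 2) * m + (m + m'))
        ((2 * N + 1) * n' + (2 * N + 2) * n + (n + n')) :=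
      S.congr rfl (by push_cast; ring) (by ring) (by ring)
    rw [h1, h2, hf]
    simp only [mul_assoc]
    congr 2
    exact S.congr rfl (by push_cast; ring) (by ring) (by ring)

/-- The expansion of affine type `A₁⁽¹⁾`. -/
theorem expansion_A11 (k : ℕ) : ∀ {e : ℕ} (s t : ℤ) {m n m' n' : ℕ}, 0 < e →
    (γ : ℤ) * (n * m' - m * n') = (2 * e : ℕ) → d ≤ m + n + k →
    S.P e s m n * S.P e t m' n' =
      fwdProd (S.real e s t m n m' n') (d + 1) *
        fwdProd (S.imag e (s + t) (m + m') (n + n')) (d + 1) *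
        bwdProd (S.real e t s m' n' m n) (d + 1) := by
  induction k with
  | zero =>
    intro e s t m n m' n' he h hd
    rw [add_comm d 1, fwdProd_add_of_eq_one (g := S.real e s t m n m' n'), add_comm 1 d,
      ← zero_add (d + 1), fwdProd_add_of_eq_one (g := S.imag _ _ _ _),
      bwdProd_add_of_eq_one (g := S.real _ _ _ _ _ _ _)]
    · simp [fwdProd_succ, real, S.vanish e s (m := m) (n := n) hd]
    · intro k _
      exact S.vanish _ _ (by
        nlinarith [Nat.zero_le (k * m'), Nat.zero_le (k * n'), Nat.zero_le (k * m),
          Nat.zero_le (k * n)])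
    · intro p _
      have : 0 < 2 ^ p := by positivity
      have h1 : d ≤ 2 ^ p * (m + m') + 2 ^ p * (n + n') := by nlinarith
      rw [imag, S.vanish _ _ h1, S.vanish _ _ h1, one_mul]
    · intro k hk
      exact S.vanish _ _ (by nlinarith [Nat.zero_le (k * m'), Nat.zero_le (k * n')])
  | succ k ih =>
    intro e s t m n m' n' he h hd
    have h2 : 0 < 2 * e := by omega
    have hu := pos_left_of_det h2 h
    have hw := pos_right_of_det h2 h
    have key := ih (2 * s + t + e) (t - e) (m := 2 * m + m') (n := 2 * n + n') (m' := m') (n' := n')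
      h2 (by rw [show ((2 * (2 * e) : ℕ) : ℤ) = 2 * (2 * e : ℕ) by push_cast; ring, ← h]
             push_cast; ring) (by omega)
    have x1 := S.exchange_short_long s (t + e) he h
    have x2 := S.exchange_short_long s (t - e) he h
    have hR := S.sweep_right s t he h (d + 1)
    have hL := S.sweep_left s t he h (d + 1)
    have v1 : S.P (2 * e) (2 * (d + 1 : ℕ) * s + (2 * (d + 1 : ℕ) + 1) * t + e)
        (2 * (d + 1) * m + (2 * (d + 1) + 1) * m') (2 * (d + 1) * n + (2 * (d + 1) + 1) * n') = 1 :=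
      S.vanish _ _ (by nlinarith [Nat.zero_le (2 * (d + 1) * m), Nat.zero_le (2 * (d + 1) * n)])
    have v2 : S.P (2 * e) ((2 * (d + 1 : ℕ) + 1) * t + (2 * (d + 1 : ℕ) + 2) * s - e)
        ((2 * (d + 1) + 1) * m' + (2 * (d + 1) + 2) * m)
        ((2 * (d + 1) + 1) * n' + (2 * (d + 1) + 2) * n) = 1 :=
      S.vanish _ _ (by
        nlinarith [Nat.zero_le ((2 * (d + 1) + 1) * m'), Nat.zero_le ((2 * (d + 1) + 1) * n')])
    rw [v1, mul_one, show 2 * (d + 1) = d + 1 + (d + 1) by ring,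
      fwdProd_add_of_eq_one (n := d + 1) (g := S.real e s t m n m' n') fun k hk =>
        S.real_eq_one _ _ _ hw (by omega)] at hR
    rw [v2, mul_one, show 2 * (d + 1) + 1 = d + 1 + (d + 2) by ring,
      bwdProd_add_of_eq_one (n := d + 1) (g := S.real e t s m' n' m n) fun k hk =>
        S.real_eq_one _ _ _ hu (by omega)] at hL
    have himag : fwdProd (S.imag e (s + t) (m + m') (n + n')) (d + 1) =
        S.P e (s + t + e) (m + m') (n + n') *
          fwdProd (S.imag (2 * e) (2 * s + t + e + (t - e)) (2 * m + m' + m') (2 * n + n' + n'))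
            (d + 1) *
          S.P e (s + t - e) (m + m') (n + n') := by
      rw [← fwdProd_add_of_eq_one (n := d + 1) (j := 1)
        (fun k hk => S.imag_eq_one _ _ (by omega) (by omega)), fwdProd_succ']
      have hs : ∀ p, S.imag e (s + t) (m + m') (n + n') (p + 1) =
          S.imag (2 * e) (2 * s + t + e + (t - e)) (2 * m + m' + m') (2 * n + n' + n') p := by
        intro p
        unfold imag
        congr 1 <;> exact S.congr (by ring) (by push_cast; ring) (by ring) (by ring)
      rw [fwdProd_congr hs]
      have h0 : S.imag e (s + t) (m + m') (n + n') 0 =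
          S.P e (s + t - e) (m + m') (n + n') * S.P e (s + t + e) (m + m') (n + n') := by
        simp [imag]
      have hc := commute_fwdProd (fun p => S.commute_imag e (2 * e) (2 * s + t + e + (t - e))
        (s + t - e) (m := m + m') (n := n + n') (m' := 2 * m + m' + m') (n' := 2 * n + n' + n')
        p (by ring)) (d + 1)
      have hc' : Commute (S.P e (s + t - e) (m + m') (n + n'))
        (S.P e (s + t + e) (m + m') (n + n')) := S.commute _ _ _ _ (by ring)
      rw [h0, mul_assoc, (hc'.mul_right hc).eq]
    rw [himag, S.fission t he hw, ← mul_assoc, x1, mul_assoc _ (S.P e s m n), x2]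
    have e1 : s + (t + e) = s + t + e := by ring
    have e2 : 2 * s + (t + e) = 2 * s + t + e := by ring
    have e3 : s + (t - e) = s + t - e := by ring
    have e4 : 2 * s + (t - e) = 2 * s + t - e := by ring
    rw [e1, e2, e3, e4]
    simp only [mul_assoc] at key hR hL ⊢
    rw [← mul_assoc (S.P (2 * e) (2 * s + t + e) _ _), key]
    simp only [mul_assoc]
    rw [hL, ← mul_assoc (S.P e (s + t + e) _ _), ← mul_assoc (S.P (2 * e) (t + e) _ _), hR]
    simp only [mul_assoc]

/-- The `k`-th pair of factors on the left of the limiting ray in type `A₂⁽²⁾`. -/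
def leftPair (f : ℕ) (β β' : ℤ) (k : ℕ) : M :=
  S.P (4 * f) ((2 * k + 1) * β + 4 * k * β') (2 * k + 1) (4 * k) *
    S.P f ((k + 1) * β + (2 * k + 1) * β') (k + 1) (2 * k + 1)

/-- The `k`-th pair of factors on the right of the limiting ray in type `A₂⁽²⁾`. -/
def rightPair (f : ℕ) (β β' : ℤ) (k : ℕ) : M :=
  S.P (4 * f) ((2 * k + 1) * β + (4 * k + 4) * β') (2 * k + 1) (4 * k + 4) *
    S.P f (k * β + (2 * k + 1) * β') k (2 * k + 1)

lemma sweep_leftPair {f : ℕ} (S : PsiSystem (4 * f) d M) (β β' : ℤ) (hf : 0 < f) (N : ℕ) :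
    S.P (4 * f) β 1 0 * S.P (2 * f) (β + β' + f) 1 1 * S.P (4 * f) (β + 2 * β' + 2 * f) 1 2 *
      fwdProd (S.real (2 * f) (β' + f) (β + β' - f) 0 1 1 1) N =
    fwdProd (S.leftPair f β β') N *
      S.P (4 * f) ((2 * N + 1) * β + 4 * N * β') (2 * N + 1) (4 * N) *
      S.P (2 * f) ((N + 1) * β + (2 * N + 1) * β' + f) (N + 1) (2 * N + 1) *
      S.P (4 * f) (β + 2 * β' + 2 * f) 1 2 := by
  induction N with
  | zero => simp
  | succ N ih =>
    rw [fwdProd_succ, ← mul_assoc, ih, fwdProd_succ]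
    have hx := S.exchange_long_short (e := 2 * f) (β + 2 * β' + 2 * f)
      ((N + 1) * β + (2 * N + 1) * β' - f) (m := 1) (n := 2) (m' := N + 1) (n' := 2 * N + 1)
      (by omega) (by push_cast; ring)
    have hff := S.fission ((N + 1) * β + (2 * N + 1) * β') (m := N + 1) (n := 2 * N + 1) hf
      (by omega)
    rw [show 2 * (2 * f) = 4 * f by ring] at hx
    have hr : S.real (2 * f) (β' + f) (β + β' - f) 0 1 1 1 N =
        S.P (2 * f) ((N + 1) * β + (2 * N + 1) * β' - f) (N + 1) (2 * N + 1) :=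
      S.congr rfl (by ring) (by ring) (by ring)
    rw [hr, mul_assoc, hx, leftPair, hff]
    simp only [mul_assoc]
    congr 4
    congr 1
    · exact S.congr rfl (by push_cast; ring) (by ring) (by ring)
    · congr 1
      exact S.congr rfl (by push_cast; ring) (by ring) (by ring)

lemma sweep_rightPair {f : ℕ} (S : PsiSystem (4 * f) d M) (β β' : ℤ) (hf : 0 < f) (N : ℕ) :
    bwdProd (S.real (2 * f) (β + β' - f) (β' + f) 1 1 0 1) N *
      S.P (4 * f) (β + 2 * β' - 2 * f) 1 2 * S.P (2 * f) (β' - f) 0 1 =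
    S.P (4 * f) (β + 2 * β' - 2 * f) 1 2 *
      S.P (2 * f) (N * β + (2 * N + 1) * β' - f) N (2 * N + 1) *
      bwdProd (S.rightPair f β β') N := by
  induction N with
  | zero => simp
  | succ N ih =>
    rw [bwdProd_succ, bwdProd_succ]
    simp only [mul_assoc] at ih ⊢
    rw [ih]
    have hx := S.exchange_short_long (e := 2 * f) (N * β + (2 * N + 1) * β' + f)
      (β + 2 * β' - 2 * f) (m := N) (n := 2 * N + 1) (m' := 1) (n' := 2)
      (by omega) (by push_cast; ring)
    have hff := S.fission (N * β + (2 * N + 1) * β') (m := N) (n := 2 * N + 1) hf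
      (by omega)
    rw [show 2 * (2 * f) = 4 * f by ring] at hx
    have hr : S.real (2 * f) (β + β' - f) (β' + f) 1 1 0 1 N =
        S.P (2 * f) (N * β + (2 * N + 1) * β' + f) N (2 * N + 1) :=
      S.congr rfl (by ring) (by ring) (by ring)
    rw [hr, ← mul_assoc, hx, rightPair, hff]
    simp only [mul_assoc]
    congr 1
    congr 1
    · exact S.congr rfl (by push_cast; ring) (by ring) (by ring)
    · congr 1
      exact S.congr rfl (by ring) (by ring) (by ring)

/-- The expansion of affine type `A₂⁽²⁾`. -/
theorem expansion_A22 {f : ℕ} (S : PsiSystem (4 * f) d M) (β β' : ℤ) (hf : 0 < f) :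
    S.P f β' 0 1 * S.P (4 * f) β 1 0 =
      fwdProd (S.leftPair f β β') (d + 1) * (S.P (2 * f) (β + 2 * β') 1 2 *
        (fwdProd (S.imag (2 * f) (β + 2 * β') 1 2) (d + 1) *
          bwdProd (S.rightPair f β β') (d + 1))) := by
  have x1 := S.exchange_short_long (e := 2 * f) (β' + f) β (m := 0) (n := 1) (m' := 1) (n' := 0)
    (by omega) (by push_cast; ring)
  have x2 := S.exchange_short_long (e := 2 * f) (β' - f) β (m := 0) (n := 1) (m' := 1) (n' := 0)
    (by omega) (by push_cast; ring)
  have key := S.expansion_A11 d (e := 2 * f) (β' + f) (β + β' - f) (m := 0) (n := 1) (m' := 1)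
    (n' := 1) (by omega) (by push_cast; ring) (by omega)
  have hR := S.sweep_leftPair β β' hf (d + 1)
  have hL := S.sweep_rightPair β β' hf (d + 1)
  rw [S.vanish (4 * f) _ (m := 2 * (d + 1) + 1) (by omega),
    S.vanish (2 * f) _ (m := d + 1 + 1) (by omega), mul_one, mul_one] at hR
  rw [S.vanish (2 * f) (_ - _) (m := d + 1) (by omega), mul_one] at hL
  have hff := S.fission (e := 2 * f) (β + 2 * β') (m := 1) (n := 2) (by omega) (by omega)
  have e0 : 2 * (2 * f) = 4 * f := by ring
  have e1 : β' + f + β = β + β' + f := by ring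
  have e2 : β' - f + β = β + β' - f := by ring
  have e3 : 2 * (β' + f) + β = β + 2 * β' + 2 * f := by ring
  have e4 : 2 * (β' - f) + β = β + 2 * β' - 2 * f := by ring
  have e5 : β' + f + (β + β' - f) = β + 2 * β' := by ring
  have e6 : ((2 * f : ℕ) : ℤ) = 2 * f := by push_cast; ring
  have hc := commute_fwdProd (fun p => S.commute_imag (4 * f) (2 * f) (β + 2 * β')
    (β + 2 * β' - 2 * f) (m := 1) (n := 2) (m' := 1) (n' := 2) p rfl) (d + 1)
  simp only [e0, e1, e2, e3, e4, e5, e6, zero_add, mul_zero, mul_one, Nat.reduceAdd]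
    at x1 x2 key hff
  simp only [mul_assoc] at x1 x2 key hR hL ⊢
  rw [S.fission β' hf (by omega), mul_assoc, x2, ← mul_assoc, x1, hff]
  simp only [mul_assoc]
  rw [← mul_assoc (S.P (2 * f) (β' + f) 0 1), key]
  simp only [mul_assoc]
  rw [hL, ← mul_assoc (S.P (4 * f) (β + 2 * β' + 2 * f) 1 2),
    ← mul_assoc (S.P (2 * f) (β + β' + f) 1 1), ← mul_assoc (S.P (4 * f) β 1 0), hR,
    ← mul_assoc (fwdProd (S.imag _ _ _ _) _), ← hc.eq]
  simp only [mul_assoc]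

end PsiSystem

section QuantumExponential

open PowerSeries Finset

variable {F : Type*} [Field F]

/-- The Euler operator `X·d/dX` on power series. -/
def eulerOp (φ : F⟦X⟧) : F⟦X⟧ := PowerSeries.mk fun n => (n : F) * coeff n φ

@[simp] lemma coeff_eulerOp (φ : F⟦X⟧) (n : ℕ) : coeff n (eulerOp φ) = n * coeff n φ := by
  simp [eulerOp]

lemma eulerOp_mul (φ ψ : F⟦X⟧) : eulerOp (φ * ψ) = eulerOp φ * ψ + φ * eulerOp ψ := by
  ext n
  simp only [coeff_eulerOp, coeff_mul, map_add, mul_sum, ← sum_add_distrib]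
  refine sum_congr rfl fun p hp => ?_
  rw [← mem_antidiagonal.1 hp]
  push_cast
  ring

lemma eulerOp_sub (φ ψ : F⟦X⟧) : eulerOp (φ - ψ) = eulerOp φ - eulerOp ψ := by
  ext n; simp [mul_sub]

lemma eulerOp_rescale (a : F) (φ : F⟦X⟧) : eulerOp (rescale a φ) = rescale a (eulerOp φ) := by
  ext n; simp only [coeff_eulerOp, coeff_rescale]; ring

lemma coeff_zero_rescale_eulerOp (a : F) (φ : F⟦X⟧) : coeff 0 (rescale a (eulerOp φ)) = 0 := by
  rw [coeff_rescale, coeff_eulerOp, Nat.cast_zero, zero_mul, mul_zero]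

lemma eulerOp_pow_succ (φ : F⟦X⟧) (k : ℕ) :
    eulerOp (φ ^ (k + 1)) = ((k : F) + 1) • (eulerOp φ * φ ^ k) := by
  induction k with
  | zero => simp
  | succ k ih =>
    rw [pow_succ, eulerOp_mul, ih, pow_succ]
    simp only [smul_eq_C_mul, map_add, map_one, Nat.cast_add, Nat.cast_one]
    ring

lemma eq_zero_of_eulerOp_eq [CharZero F] {G D : F⟦X⟧} (hG : coeff 0 G = 0) (hD : coeff 0 D = 0)
    (h : eulerOp D = G * D) : D = 0 := by
  ext n
  induction n using Nat.strong_induction_on with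
  | _ n ih =>
    rcases Nat.eq_zero_or_pos n with rfl | hn
    · simpa using hD
    · have h1 := congrArg (coeff n) h
      rw [coeff_eulerOp, coeff_mul, sum_eq_zero] at h1
      · have : (n : F) ≠ 0 := by exact_mod_cast hn.ne'
        simpa [this] using h1
      · intro p hp
        rcases Nat.eq_zero_or_pos p.1 with h0 | h0
        · rw [h0, hG, zero_mul]
        · rw [ih p.2 (by have := mem_antidiagonal.1 hp; omega)]
          simp

/-- The exponential of a power series without constant term. -/
def expSeries (L : F⟦X⟧) : F⟦X⟧ :=
  PowerSeries.mk fun n => ∑ k ∈ range (n + 1), ((Nat.factorial k : F)⁻¹) * coeff n (L ^ k)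

lemma coeff_pow_eq_zero_of_lt {L : F⟦X⟧} (hL : coeff 0 L = 0) {n k : ℕ} (h : n < k) :
    coeff n (L ^ k) = 0 := by
  have h1 : (X : F⟦X⟧) ∣ L := X_dvd_iff.2 (by simpa using hL)
  exact X_pow_dvd_iff.1 (pow_dvd_pow_of_dvd h1 k) n h

lemma coeff_expSeries {L : F⟦X⟧} (hL : coeff 0 L = 0) {n m : ℕ} (h : n < m) :
    coeff n (expSeries L) = coeff n (∑ k ∈ range m, ((Nat.factorial k : F)⁻¹) • L ^ k) := by
  rw [expSeries, coeff_mk, map_sum]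
  simp only [coeff_smul]
  refine sum_subset (range_subset_range.2 h) fun k _ hk => ?_
  rw [coeff_pow_eq_zero_of_lt hL (by simpa using hk), mul_zero]

lemma coeff_zero_expSeries (L : F⟦X⟧) : coeff 0 (expSeries L) = 1 := by
  simp [expSeries]

lemma eulerOp_expSeries [CharZero F] {L : F⟦X⟧} (hL : coeff 0 L = 0) :
    eulerOp (expSeries L) = eulerOp L * expSeries L := by
  have key : ∀ m, eulerOp (∑ k ∈ range (m + 1), ((Nat.factorial k : F)⁻¹) • L ^ k) =
      eulerOp L * ∑ k ∈ range m, ((Nat.factorial k : F)⁻¹) • L ^ k := by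
    intro m
    rw [sum_range_succ', mul_sum]
    have : ∀ k ∈ range m, eulerOp L * (((Nat.factorial k : F)⁻¹) • L ^ k) =
        ((Nat.factorial (k + 1) : F)⁻¹) • eulerOp (L ^ (k + 1)) := by
      intro k _
      have h1 : (k : F) + 1 ≠ 0 := by exact_mod_cast k.succ_ne_zero
      rw [eulerOp_pow_succ, mul_smul_comm, smul_smul, Nat.factorial_succ]
      congr 1
      push_cast
      field_simp
    rw [sum_congr rfl this]
    ext n
    simp only [coeff_eulerOp, map_add, map_sum, coeff_smul, mul_add, mul_sum, smul_eq_mul]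
    simp only [mul_left_comm (n : F), pow_zero, coeff_one]
    rw [add_eq_left]
    split_ifs with h <;> simp [h]
  ext n
  rw [coeff_eulerOp, coeff_expSeries hL (show n < n + 1 + 1 by omega), ← coeff_eulerOp, key,
    coeff_mul, coeff_mul]
  refine sum_congr rfl fun p hp => ?_
  have := mem_antidiagonal.1 hp
  rw [coeff_expSeries hL (show p.2 < n + 1 by omega)]

/-- The logarithm of the quantum dilogarithm. -/
def dilogLog (w : F) : F⟦X⟧ :=
  PowerSeries.mk fun j => (-1) ^ (j + 1) / ((j : F) * (w ^ j - w⁻¹ ^ j))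

/-- The quantum dilogarithm as a power series. -/
def dilogSeries (w : F) : F⟦X⟧ := expSeries (dilogLog w)

lemma coeff_zero_dilogLog (w : F) : coeff 0 (dilogLog w) = 0 := by simp [dilogLog]

lemma pow_sub_inv_pow_ne_zero {w : F} (h0 : w ≠ 0) {j : ℕ} (h : w ^ (2 * j) ≠ 1) :
    w ^ j - w⁻¹ ^ j ≠ 0 := by
  intro h1
  apply h
  rw [two_mul, pow_add]
  nth_rw 1 [sub_eq_zero.1 h1]
  rw [inv_pow, inv_mul_cancel₀ (pow_ne_zero _ h0)]

variable [CharZero F]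

lemma coeff_eulerOp_dilogLog (w : F) {j : ℕ} (hj : 0 < j) :
    coeff j (eulerOp (dilogLog w)) = (-1) ^ (j + 1) / (w ^ j - w⁻¹ ^ j) := by
  have : (j : F) ≠ 0 := by exact_mod_cast hj.ne'
  rw [coeff_eulerOp, dilogLog, coeff_mk]
  field_simp

lemma eulerOp_dilogSeries (w : F) :
    eulerOp (dilogSeries w) = eulerOp (dilogLog w) * dilogSeries w :=
  eulerOp_expSeries (coeff_zero_dilogLog w)

lemma dilogSeries_rescale {w : F} (h0 : w ≠ 0) (hw : ∀ j, 0 < j → w ^ (2 * j) ≠ 1) :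
    rescale w (dilogSeries w) = (1 + X) * rescale w⁻¹ (dilogSeries w) := by
  have hX : (rescale w (eulerOp (dilogLog w)) - rescale w⁻¹ (eulerOp (dilogLog w))) * (1 + X) =
      eulerOp (1 + X : F⟦X⟧) := by
    have hc : ∀ j, 0 < j → coeff j (rescale w (eulerOp (dilogLog w)) -
        rescale w⁻¹ (eulerOp (dilogLog w))) = (-1) ^ (j + 1) := by
      intro j hj
      rw [map_sub, coeff_rescale, coeff_rescale, ← sub_mul, coeff_eulerOp_dilogLog w hj,
        mul_div_cancel₀ _ (pow_sub_inv_pow_ne_zero h0 (hw j hj))]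
    ext n
    rw [mul_add, mul_one, map_add]
    rcases n with _ | _ | n
    · rw [map_sub, coeff_zero_rescale_eulerOp, coeff_zero_rescale_eulerOp, coeff_zero_mul_X]
      simp
    · rw [hc _ (by omega), coeff_succ_mul_X, map_sub, coeff_zero_rescale_eulerOp,
        coeff_zero_rescale_eulerOp]
      simp [coeff_one]
    · rw [hc _ (by omega), coeff_succ_mul_X, hc _ (by omega)]
      simp [coeff_one, coeff_X, pow_succ]
  rw [← sub_eq_zero]
  refine eq_zero_of_eulerOp_eq (G := rescale w (eulerOp (dilogLog w))) (by simp) ?_ ?_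
  · simp [add_mul, dilogSeries, coeff_zero_expSeries, -coeff_zero_eq_constantCoeff,
      coeff_rescale, coeff_zero_X_mul]
  · rw [eulerOp_sub, eulerOp_mul, eulerOp_rescale, eulerOp_rescale, eulerOp_dilogSeries, ← hX,
      map_mul, map_mul]
    ring

/-- The coefficient recurrence of the quantum dilogarithm. -/
lemma coeff_dilogSeries_succ {w : F} (h0 : w ≠ 0) (hw : ∀ j, 0 < j → w ^ (2 * j) ≠ 1) (k : ℕ) :
    (w ^ (2 * (k + 1)) - 1) * coeff (k + 1) (dilogSeries w) = w * coeff k (dilogSeries w) := by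
  have h := congrArg (coeff (k + 1)) (dilogSeries_rescale h0 hw)
  rw [add_mul, one_mul, map_add, coeff_succ_X_mul, coeff_rescale, coeff_rescale, coeff_rescale,
    inv_pow, inv_pow] at h
  have h1 : w ^ (k + 1) * (w ^ (k + 1))⁻¹ = 1 := mul_inv_cancel₀ (pow_ne_zero _ h0)
  have h2 : w ^ (k + 1) * (w ^ k)⁻¹ = w := by
    rw [pow_succ', mul_assoc, mul_inv_cancel₀ (pow_ne_zero _ h0), mul_one]
  linear_combination w ^ (k + 1) * h + coeff (k + 1) (dilogSeries w) * h1 +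
    coeff k (dilogSeries w) * h2

lemma dilogSeries_fission {w : F} (h0 : w ≠ 0) (hw : ∀ j, 0 < j → w ^ (2 * j) ≠ 1) :
    dilogSeries w = rescale w (dilogSeries (w ^ 2)) * rescale w⁻¹ (dilogSeries (w ^ 2)) := by
  have hG : eulerOp (dilogLog w) = rescale w (eulerOp (dilogLog (w ^ 2))) +
      rescale w⁻¹ (eulerOp (dilogLog (w ^ 2))) := by
    ext n
    rcases Nat.eq_zero_or_pos n with rfl | hn
    · rw [map_add, coeff_zero_rescale_eulerOp, coeff_zero_rescale_eulerOp, coeff_eulerOp]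
      simp
    · rw [map_add, coeff_rescale, coeff_rescale, coeff_eulerOp_dilogLog _ hn,
        coeff_eulerOp_dilogLog _ hn]
      have h1 := pow_sub_inv_pow_ne_zero h0 (hw n hn)
      have h2 : w ^ n + w⁻¹ ^ n ≠ 0 := by
        intro h2
        refine pow_sub_inv_pow_ne_zero h0 (hw (2 * n) (by omega)) ?_
        linear_combination (w ^ n - w⁻¹ ^ n) * h2
      have h3 : (w ^ 2) ^ n - (w ^ 2)⁻¹ ^ n = (w ^ n + w⁻¹ ^ n) * (w ^ n - w⁻¹ ^ n) := by
        rw [← inv_pow]; ring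
      rw [h3]
      generalize w ^ n = x at *
      generalize w⁻¹ ^ n = y at *
      field_simp
  rw [← sub_eq_zero]
  refine eq_zero_of_eulerOp_eq (G := eulerOp (dilogLog w)) (by simp) ?_ ?_
  · simp [dilogSeries, coeff_zero_expSeries, -coeff_zero_eq_constantCoeff, coeff_rescale, coeff_mul]
  · rw [eulerOp_sub, eulerOp_mul, eulerOp_rescale, eulerOp_rescale, eulerOp_dilogSeries,
      eulerOp_dilogSeries, map_mul, map_mul, hG]
    ring

end QuantumExponential

section TruncatedEvaluation

open PowerSeries Finset

variable {F R : Type*} [Field F] [Ring R] [Algebra F R]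

lemma sum_range_sum_range_eq_antidiagonal {A : Type*} [AddCommMonoid A] {d : ℕ} {f : ℕ → ℕ → A}
    (h : ∀ i j, d ≤ i + j → f i j = 0) :
    ∑ i ∈ range d, ∑ j ∈ range d, f i j =
      ∑ n ∈ range d, ∑ p ∈ antidiagonal n, f p.1 p.2 := by
  simp only [Nat.sum_antidiagonal_eq_sum_range_succ f, sum_range_diag_flip]
  refine sum_congr rfl fun i _ => (sum_subset (range_subset_range.2 (by omega)) ?_).symm
  intro j _ hj
  exact h i j (by simp at hj; omega)

/-- The value at `z` of the truncation of a power series below degree `d`. -/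
def evalTrunc (d : ℕ) (z : R) (φ : F⟦X⟧) : R := ∑ k ∈ range d, coeff k φ • z ^ k

lemma evalTrunc_mul {d : ℕ} {z : R} (hz : z ^ d = 0) (φ ψ : F⟦X⟧) :
    evalTrunc d z (φ * ψ) = evalTrunc d z φ * evalTrunc d z ψ := by
  simp only [evalTrunc, sum_mul_sum]
  rw [sum_range_sum_range_eq_antidiagonal]
  · refine sum_congr rfl fun n _ => ?_
    rw [coeff_mul, sum_smul]
    refine sum_congr rfl fun p hp => ?_
    rw [smul_mul_smul_comm, ← pow_add, mem_antidiagonal.1 hp]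
  · intro i j hij
    rw [smul_mul_smul_comm, ← pow_add, pow_eq_zero_of_le hij hz, smul_zero]

lemma evalTrunc_one {d : ℕ} (hd : 0 < d) (z : R) : evalTrunc d z (1 : F⟦X⟧) = 1 := by
  obtain ⟨d, rfl⟩ : ∃ n, d = n + 1 := ⟨d - 1, by omega⟩
  simp [evalTrunc, coeff_one]

lemma evalTrunc_pow {d : ℕ} (hd : 0 < d) {z : R} (hz : z ^ d = 0) (φ : F⟦X⟧) (k : ℕ) :
    evalTrunc d z (φ ^ k) = evalTrunc d z φ ^ k := by
  induction k with
  | zero => simp [evalTrunc_one hd]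
  | succ k ih => rw [pow_succ, evalTrunc_mul hz, ih, pow_succ]

lemma evalTrunc_rescale (d : ℕ) (z : R) (a : F) (φ : F⟦X⟧) :
    evalTrunc d z (rescale a φ) = evalTrunc d (a • z) φ := by
  simp only [evalTrunc, coeff_rescale, smul_pow, smul_smul, mul_comm]

lemma evalTrunc_zero {d : ℕ} (hd : 0 < d) (φ : F⟦X⟧) :
    evalTrunc d (0 : R) φ = coeff 0 φ • 1 := by
  obtain ⟨d, rfl⟩ : ∃ n, d = n + 1 := ⟨d - 1, by omega⟩
  simp [evalTrunc, sum_range_succ']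

lemma evalTrunc_expSeries {d : ℕ} (hd : 0 < d) {z : R} (hz : z ^ d = 0) {L : F⟦X⟧}
    (hL : coeff 0 L = 0) :
    evalTrunc d z (expSeries L) =
      ∑ k ∈ range d, ((Nat.factorial k : F)⁻¹) • evalTrunc d z L ^ k := by
  have h : evalTrunc d z (expSeries L) =
      evalTrunc d z (∑ k ∈ range d, ((Nat.factorial k : F)⁻¹) • L ^ k) := by
    refine sum_congr rfl fun n hn => ?_
    rw [coeff_expSeries hL (mem_range.1 hn)]
  rw [h]
  simp only [← evalTrunc_pow hd hz]
  simp only [evalTrunc, map_sum, coeff_smul, sum_smul, smul_sum, smul_smul, smul_eq_mul]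
  exact sum_comm

lemma Commute.evalTrunc {d : ℕ} {y z : R} (h : Commute y z) (φ ψ : F⟦X⟧) :
    Commute (evalTrunc d y φ) (evalTrunc d z ψ) :=
  Commute.sum_left _ _ _ fun i _ => Commute.sum_right _ _ _ fun j _ =>
    ((h.pow_pow i j).smul_left _).smul_right _

/-- The `q`-binomial theorem for the exponential series attached to `c`. -/
lemma qBinomial {w : F} (hw : ∀ j, 0 < j → w ^ (2 * j) ≠ 1) {c : ℕ → F} (c0 : c 0 = 1)
    (hc : ∀ k, (w ^ (2 * (k + 1)) - 1) * c (k + 1) = w * c k) {A B : R}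
    (h : B * A = w ^ 2 • (A * B)) (n : ℕ) :
    c n • (A + B) ^ n = ∑ p ∈ antidiagonal n, (c p.1 * c p.2) • (A ^ p.1 * B ^ p.2) := by
  have hBA : ∀ i, B * A ^ i = w ^ (2 * i) • (A ^ i * B) := by
    intro i
    induction i with
    | zero => simp
    | succ i ih =>
      rw [pow_succ, ← mul_assoc, ih, smul_mul_assoc, mul_assoc, h, mul_smul_comm, smul_smul,
        ← mul_assoc]
      congr 1
      ring
  induction n with
  | zero => simp [c0]
  | succ n ih =>
    have hne : w ^ (2 * (n + 1)) - 1 ≠ 0 := sub_ne_zero.2 (hw _ (by omega))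
    have key : (w ^ (2 * (n + 1)) - 1) • c (n + 1) • (A + B) ^ (n + 1) =
        (w ^ (2 * (n + 1)) - 1) •
          ∑ p ∈ antidiagonal (n + 1), (c p.1 * c p.2) • (A ^ p.1 * B ^ p.2) := by
      rw [smul_smul, hc, pow_succ', ← smul_smul, ← mul_smul_comm, ih, smul_sum]
      have split : ∀ p ∈ antidiagonal (n + 1),
          (w ^ (2 * (n + 1)) - 1) • (c p.1 * c p.2) • (A ^ p.1 * B ^ p.2) =
          ((w ^ (2 * p.1) - 1) * c p.1 * c p.2) • (A ^ p.1 * B ^ p.2) +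
          (w ^ (2 * p.1) * (c p.1 * ((w ^ (2 * p.2) - 1) * c p.2))) • (A ^ p.1 * B ^ p.2) := by
        intro p hp
        rw [smul_smul, ← add_smul, ← mem_antidiagonal.1 hp]
        congr 1
        ring
      rw [sum_congr rfl split, sum_add_distrib, Nat.sum_antidiagonal_succ,
        Nat.sum_antidiagonal_succ']
      simp only [hc, mul_zero, pow_zero, sub_self, zero_mul, zero_smul, zero_add]
      rw [← sum_add_distrib, mul_sum, smul_sum]
      refine sum_congr rfl fun p _ => ?_
      rw [mul_smul_comm, add_mul, ← mul_assoc, ← mul_assoc, hBA, smul_mul_assoc, mul_assoc (A ^ _),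
        ← pow_succ', ← pow_succ']
      module
    exact smul_right_injective R hne key

/-- The pentagon relation for truncated quantum dilogarithms. -/
lemma evalTrunc_pentagon [CharZero F] {w : F} (h0 : w ≠ 0) (hw : ∀ j, 0 < j → w ^ (2 * j) ≠ 1)
    {d : ℕ} {U V : R} (h : U * V = w ^ 2 • (V * U)) (hnil : ∀ i j, d ≤ i + j → V ^ i * U ^ j = 0) :
    evalTrunc d U (dilogSeries w) * evalTrunc d V (dilogSeries w) =
      evalTrunc d V (dilogSeries w) * evalTrunc d (w • (V * U)) (dilogSeries w) *
        evalTrunc d U (dilogSeries w) := by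
  set c : ℕ → F := fun k => coeff k (dilogSeries w) with hcdef
  have c0 : c 0 = 1 := coeff_zero_expSeries _
  have hc : ∀ k, (w ^ (2 * (k + 1)) - 1) * c (k + 1) = w * c k := coeff_dilogSeries_succ h0 hw
  have hUV : ∀ i, U ^ i * V = w ^ (2 * i) • (V * U ^ i) := by
    intro i
    induction i with
    | zero => simp
    | succ i ih =>
      rw [pow_succ', mul_assoc, ih, mul_smul_comm, ← mul_assoc, h, smul_mul_assoc, smul_smul,
        mul_assoc]
      congr 1
      ring
  have hconj : evalTrunc d U (dilogSeries w) * V =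
      (V + w • (V * U)) * evalTrunc d U (dilogSeries w) := by
    have e1 : evalTrunc d U (dilogSeries w) * V - V * evalTrunc d U (dilogSeries w) =
        ∑ k ∈ range d, (c k * (w ^ (2 * k) - 1)) • (V * U ^ k) := by
      simp only [evalTrunc, sum_mul, mul_sum, ← sum_sub_distrib]
      refine sum_congr rfl fun k _ => ?_
      rw [smul_mul_assoc, hUV, mul_smul_comm, smul_smul, ← sub_smul, hcdef]
      congr 1
      ring
    have e2 : (w • (V * U)) * evalTrunc d U (dilogSeries w) =
        ∑ k ∈ range d, (c k * (w ^ (2 * k) - 1)) • (V * U ^ k) := by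
      have : ∑ k ∈ range (d + 1), (c k * (w ^ (2 * k) - 1)) • (V * U ^ k) =
          ∑ k ∈ range d, (c k * (w ^ (2 * k) - 1)) • (V * U ^ k) := by
        rw [sum_range_succ, ← pow_one V, hnil 1 d (by omega), smul_zero, add_zero]
      rw [← this, sum_range_succ']
      simp only [evalTrunc, mul_sum, mul_zero, pow_zero, sub_self, zero_smul, add_zero]
      refine sum_congr rfl fun k _ => ?_
      rw [mul_comm (c _), hc, smul_mul_smul_comm, mul_assoc, ← pow_succ']
    rw [add_mul, e2, ← e1]
    abel
  have hpow : ∀ n, evalTrunc d U (dilogSeries w) * V ^ n =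
      (V + w • (V * U)) ^ n * evalTrunc d U (dilogSeries w) := by
    intro n
    induction n with
    | zero => simp
    | succ n ih => rw [pow_succ, ← mul_assoc, ih, mul_assoc, hconj, ← mul_assoc, ← pow_succ]
  have hVU : ∀ j, ∃ a : F, (w • (V * U)) ^ j = a • (V ^ j * U ^ j) := by
    intro j
    induction j with
    | zero => exact ⟨1, by simp⟩
    | succ j ih =>
      obtain ⟨a, ha⟩ := ih
      refine ⟨a * w * w ^ (2 * j), ?_⟩
      rw [pow_succ, ha, smul_mul_smul_comm, mul_assoc, ← mul_assoc _ V, hUV, smul_mul_assoc,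
        mul_smul_comm, smul_smul, mul_assoc V, ← mul_assoc, ← pow_succ, ← pow_succ]
  have hAB : w • (V * U) * V = w ^ 2 • (V * (w • (V * U))) := by
    rw [smul_mul_assoc, mul_assoc, h, mul_smul_comm, mul_smul_comm, smul_comm]
  have hsum : evalTrunc d V (dilogSeries w) * evalTrunc d (w • (V * U)) (dilogSeries w) =
      ∑ n ∈ range d, c n • (V + w • (V * U)) ^ n := by
    simp only [evalTrunc, sum_mul_sum]
    rw [sum_range_sum_range_eq_antidiagonal]
    · refine sum_congr rfl fun n _ => ?_
      rw [qBinomial hw c0 hc hAB]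
      exact sum_congr rfl fun p _ => smul_mul_smul_comm _ _ _ _
    · intro i j hij
      obtain ⟨a, ha⟩ := hVU j
      rw [smul_mul_smul_comm, ha, mul_smul_comm, ← mul_assoc, ← pow_add, hnil _ _ (by omega),
        smul_zero, smul_zero]
  rw [hsum, sum_mul]
  nth_rw 2 [evalTrunc]
  rw [mul_sum]
  refine sum_congr rfl fun n _ => ?_
  rw [mul_smul_comm, hpow, smul_mul_assoc]

end TruncatedEvaluation

section QuantumPlaneRing

open Finset

/-- The completed quantum plane `A_γ`, as a type carrying its ring structure. -/
def QAlg (_γ : ℕ) : Type := QP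

namespace QAlg

variable {γ : ℕ}

instance : AddCommGroup (QAlg γ) := inferInstanceAs (AddCommGroup QP)

instance : Module K (QAlg γ) := inferInstanceAs (Module K QP)

instance : Mul (QAlg γ) := ⟨qmul γ⟩

instance : One (QAlg γ) := ⟨qone⟩

lemma mul_apply (F G : QAlg γ) (p : ℕ × ℕ) : (F * G) p =
    ∑ a ∈ range (p.1 + 1), ∑ b ∈ range (p.2 + 1),
      v ^ (2 * γ * b * (p.1 - a)) * F (a, b) * G (p.1 - a, p.2 - b) := rfl

lemma one_apply (p : ℕ × ℕ) : (1 : QAlg γ) p = if p = (0, 0) then 1 else 0 := rfl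

lemma add_apply (F G : QAlg γ) (p : ℕ × ℕ) : (F + G) p = F p + G p := rfl

lemma zero_apply (p : ℕ × ℕ) : (0 : QAlg γ) p = 0 := rfl

lemma smul_apply (c : K) (F : QAlg γ) (p : ℕ × ℕ) : (c • F) p = c * F p := rfl

lemma sum_apply {ι : Type*} (t : Finset ι) (F : ι → QAlg γ) (p : ℕ × ℕ) :
    (∑ i ∈ t, F i) p = ∑ i ∈ t, F i p :=
  Finset.sum_apply p t F

lemma ext {F G : QAlg γ} (h : ∀ p, F p = G p) : F = G := funext h

lemma sum_range_triple {A : Type*} [AddCommMonoid A] (n : ℕ) (h : ℕ → ℕ → ℕ → A) :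
    ∑ a ∈ range (n + 1), ∑ a' ∈ range (a + 1), h a' (a - a') (n - a) =
      ∑ a ∈ range (n + 1), ∑ a' ∈ range (n - a + 1), h a a' (n - a - a') := by
  have := sum_range_diag_flip (n + 1) fun k l => h k l (n - k - l)
  rw [sum_congr rfl fun a ha => sum_congr rfl fun a' ha' => ?_, this]
  · refine sum_congr rfl fun a ha => ?_
    rw [show n + 1 - a = n - a + 1 by have := mem_range.1 ha; omega]
  · congr 1
    have := mem_range.1 ha'
    omega

protected lemma mul_assoc (F G H : QAlg γ) : F * G * H = F * (G * H) := by
  refine ext fun p => ?_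
  set T : ℕ → ℕ → ℕ → ℕ → ℕ → ℕ → K := fun a a' a'' b b' b'' =>
    v ^ (2 * γ * (b * a' + b * a'' + b' * a'')) * F (a, b) * G (a', b') * H (a'', b'') with hT
  have hl : (F * G * H) p = ∑ a ∈ range (p.1 + 1), ∑ a' ∈ range (a + 1),
      ∑ b ∈ range (p.2 + 1), ∑ b' ∈ range (b + 1),
        T a' (a - a') (p.1 - a) b' (b - b') (p.2 - b) := by
    rw [mul_apply]
    refine sum_congr rfl fun a _ => ?_
    rw [sum_comm]
    refine sum_congr rfl fun b _ => ?_
    rw [mul_apply, mul_sum, sum_mul]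
    refine sum_congr rfl fun a' _ => ?_
    rw [mul_sum, sum_mul]
    refine sum_congr rfl fun b' hb' => ?_
    obtain ⟨c, rfl⟩ := Nat.exists_eq_add_of_le (Nat.lt_succ_iff.1 (mem_range.1 hb'))
    simp only [hT, add_tsub_cancel_left]
    ring
  have hr : (F * (G * H)) p = ∑ a ∈ range (p.1 + 1), ∑ a' ∈ range (p.1 - a + 1),
      ∑ b ∈ range (p.2 + 1), ∑ b' ∈ range (p.2 - b + 1),
        T a a' (p.1 - a - a') b b' (p.2 - b - b') := by
    rw [mul_apply]
    refine sum_congr rfl fun a _ => ?_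
    rw [sum_comm]
    refine sum_congr rfl fun b _ => ?_
    rw [mul_apply, mul_sum]
    refine sum_congr rfl fun a' ha' => ?_
    rw [mul_sum]
    refine sum_congr rfl fun b' _ => ?_
    obtain ⟨c, hc⟩ := Nat.exists_eq_add_of_le (Nat.lt_succ_iff.1 (mem_range.1 ha'))
    simp only [hT, hc, add_tsub_cancel_left]
    ring
  rw [hl, hr, sum_range_triple p.1 fun a a' a'' => ∑ b ∈ range (p.2 + 1), ∑ b' ∈ range (b + 1),
    T a a' a'' b' (b - b') (p.2 - b)]
  refine sum_congr rfl fun a _ => sum_congr rfl fun a' _ => ?_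
  exact sum_range_triple p.2 fun b b' b'' => T a a' (p.1 - a - a') b b' b''

protected lemma one_mul (F : QAlg γ) : 1 * F = F := by
  refine ext fun p => ?_
  rw [mul_apply, sum_eq_single 0, sum_eq_single 0]
  · simp [one_apply]
  · intro b _ hb
    simp [one_apply, hb]
  · simp
  · intro a _ ha
    exact sum_eq_zero fun b _ => by simp [one_apply, ha]
  · simp

protected lemma mul_one (F : QAlg γ) : F * 1 = F := by
  refine ext fun p => ?_
  rw [mul_apply, sum_eq_single p.1, sum_eq_single p.2]
  · simp [one_apply]
  · intro b hb hb'
    have : p.2 - b ≠ 0 := by have := mem_range.1 hb; omega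
    simp [one_apply, this]
  · simp
  · intro a ha ha'
    have : p.1 - a ≠ 0 := by have := mem_range.1 ha; omega
    exact sum_eq_zero fun b _ => by simp [one_apply, this]
  · simp

instance : Ring (QAlg γ) :=
  { (inferInstance : AddCommGroup (QAlg γ)), (inferInstance : Mul (QAlg γ)),
    (inferInstance : One (QAlg γ)) with
    mul_assoc := QAlg.mul_assoc
    one_mul := QAlg.one_mul
    mul_one := QAlg.mul_one
    left_distrib := fun F G H => ext fun p => by
      simp only [mul_apply, add_apply, mul_add, sum_add_distrib]
    right_distrib := fun F G H => ext fun p => by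
      simp only [mul_apply, add_apply, mul_add, add_mul, sum_add_distrib]
    zero_mul := fun F => ext fun p => by simp [mul_apply, zero_apply]
    mul_zero := fun F => ext fun p => by simp [mul_apply, zero_apply] }

instance : Algebra K (QAlg γ) := Algebra.ofModule
  (fun c F G => ext fun p => by
    simp only [mul_apply, smul_apply, mul_sum]
    exact sum_congr rfl fun a _ => sum_congr rfl fun b _ => by ring)
  (fun c F G => ext fun p => by
    simp only [mul_apply, smul_apply, mul_sum]
    exact sum_congr rfl fun a _ => sum_congr rfl fun b _ => by ring)

lemma qpow_eq (Z : QAlg γ) (k : ℕ) : qpow γ Z k = Z ^ k := by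
  induction k with
  | zero => rfl
  | succ k ih => rw [pow_succ', ← ih]; rfl

/-- `F` has no terms of total degree less than `k`. -/
def OrderGE (k : ℕ) (F : QAlg γ) : Prop := ∀ p : ℕ × ℕ, p.1 + p.2 < k → F p = 0

lemma OrderGE.mul {k l : ℕ} {F G : QAlg γ} (hF : OrderGE k F) (hG : OrderGE l G) :
    OrderGE (k + l) (F * G) := by
  intro p hp
  rw [mul_apply]
  refine sum_eq_zero fun a ha => sum_eq_zero fun b hb => ?_
  have h1 := mem_range.1 ha
  have h2 := mem_range.1 hb
  by_cases h : a + b < k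
  · rw [hF (a, b) h, mul_zero, zero_mul]
  · rw [hG (p.1 - a, p.2 - b) (by dsimp only; omega), mul_zero]

lemma OrderGE.pow {F : QAlg γ} (hF : OrderGE 1 F) (k : ℕ) : OrderGE k (F ^ k) := by
  induction k with
  | zero => intro p hp; omega
  | succ k ih => rw [pow_succ]; exact ih.mul hF

/-- Agreement of coefficients in total degree less than `d`, as a ring congruence. -/
def truncCon (γ d : ℕ) : RingCon (QAlg γ) where
  r F G := ∀ p : ℕ × ℕ, p.1 + p.2 < d → F p = G p
  iseqv := ⟨fun _ _ _ => rfl, fun h p hp => (h p hp).symm,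
    fun h h' p hp => (h p hp).trans (h' p hp)⟩
  add' h h' p hp := by rw [add_apply, add_apply, h p hp, h' p hp]
  mul' h h' p hp := by
    rw [mul_apply, mul_apply]
    refine sum_congr rfl fun a ha => sum_congr rfl fun b hb => ?_
    have h1 := mem_range.1 ha
    have h2 := mem_range.1 hb
    rw [h (a, b) (by dsimp only; omega), h' (p.1 - a, p.2 - b) (by dsimp only; omega)]

/-- The truncation of the quantum plane in total degree less than `d`. -/
abbrev Trunc (γ d : ℕ) : Type := (truncCon γ d).Quotient

/-- The projection to the truncation. -/
def toTrunc (γ d : ℕ) : QAlg γ →ₐ[K] Trunc γ d := (truncCon γ d).mkₐ K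

lemma toTrunc_eq_iff {d : ℕ} {F G : QAlg γ} :
    toTrunc γ d F = toTrunc γ d G ↔ ∀ p : ℕ × ℕ, p.1 + p.2 < d → F p = G p :=
  RingCon.eq (truncCon γ d)

lemma toTrunc_eq_zero {d k : ℕ} {F : QAlg γ} (hF : OrderGE k F) (hk : d ≤ k) :
    toTrunc γ d F = 0 := by
  rw [← map_zero (toTrunc γ d), toTrunc_eq_iff]
  exact fun p hp => hF p (by omega)

/-- The logarithm of the quantum dilogarithm, as an element of the ring `A_γ`. -/
def psiLog (w : K) (Z : QAlg γ) : QAlg γ := qarg γ w Z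

/-- The quantum dilogarithm, as an element of the ring `A_γ`. -/
def psi (w : K) (Z : QAlg γ) : QAlg γ := qPsi γ w Z

lemma psiLog_apply (w : K) (Z : QAlg γ) (p : ℕ × ℕ) : psiLog w Z p =
    ∑ j ∈ Icc 1 (p.1 + p.2), ((-1 : K) ^ (j + 1) / ((j : K) * (w ^ j - w⁻¹ ^ j))) * (Z ^ j) p := by
  simp only [← qpow_eq]; rfl

lemma psi_apply (w : K) (Z : QAlg γ) (p : ℕ × ℕ) : psi w Z p =
    ∑ k ∈ range (p.1 + p.2 + 1), ((Nat.factorial k : K)⁻¹) * (psiLog w Z ^ k) p := by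
  simp only [← qpow_eq]; rfl

lemma orderGE_psiLog (w : K) (Z : QAlg γ) : OrderGE 1 (psiLog w Z) := by
  intro p hp
  have : p.1 + p.2 = 0 := by omega
  simp [psiLog_apply, this]

lemma toTrunc_psiLog {d : ℕ} (w : K) {Z : QAlg γ} (hZ : OrderGE 1 Z) :
    toTrunc γ d (psiLog w Z) = evalTrunc d (toTrunc γ d Z) (dilogLog w) := by
  simp only [evalTrunc, ← map_pow, ← map_smul, ← map_sum]
  rw [toTrunc_eq_iff]
  intro p hp
  rw [sum_apply, psiLog_apply]
  simp only [smul_apply, dilogLog, PowerSeries.coeff_mk]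
  refine sum_subset (fun j hj => ?_) fun j _ hj => ?_
  · have := mem_Icc.1 hj
    exact mem_range.2 (by omega)
  · rcases Nat.eq_zero_or_pos j with rfl | h0
    · simp
    · have hlt : p.1 + p.2 < j := by
        by_contra h
        exact hj (mem_Icc.2 ⟨h0, by omega⟩)
      rw [hZ.pow j p hlt, mul_zero]

lemma toTrunc_psi {d : ℕ} (hd : 0 < d) (w : K) {Z : QAlg γ} (hZ : OrderGE 1 Z) :
    toTrunc γ d (psi w Z) = evalTrunc d (toTrunc γ d Z) (dilogSeries w) := by
  have hz : toTrunc γ d Z ^ d = 0 := by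
    rw [← map_pow]; exact toTrunc_eq_zero (hZ.pow d) le_rfl
  rw [dilogSeries, evalTrunc_expSeries hd hz (coeff_zero_dilogLog w), ← toTrunc_psiLog w hZ]
  simp only [← map_pow, ← map_smul, ← map_sum]
  rw [toTrunc_eq_iff]
  intro p hp
  rw [sum_apply, psi_apply]
  simp only [smul_apply]
  refine sum_subset (range_subset_range.2 (by omega)) fun k _ hk => ?_
  rw [(orderGE_psiLog w Z).pow k p (by simp at hk; omega), mul_zero]

/-- The scaled quantum monomial `v^s·y^{(m,n)}`. -/
def mono (γ : ℕ) (s : ℤ) (m n : ℕ) : QAlg γ := qy γ s m n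

lemma mono_apply (s : ℤ) (m n : ℕ) (p : ℕ × ℕ) : mono γ s m n p =
    if p = (m, n) then v ^ (s + (γ : ℤ) * (m : ℤ) * (n : ℤ)) else 0 := rfl

lemma v_ne_zero : v ≠ 0 := RatFunc.X_ne_zero

lemma v_pow_ne_one {n : ℕ} (hn : 0 < n) : v ^ n ≠ 1 := by
  intro h
  have h1 : algebraMap (Polynomial ℚ) K (Polynomial.X ^ n) = algebraMap (Polynomial ℚ) K 1 := by
    rw [map_pow, map_one, RatFunc.algebraMap_X]; exact h
  have h2 := congrArg Polynomial.natDegree (RatFunc.algebraMap_injective ℚ h1)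
  simp at h2
  omega

lemma v_pow_pow_ne_one {e : ℕ} (he : 0 < e) (j : ℕ) (hj : 0 < j) : (v ^ e) ^ (2 * j) ≠ 1 := by
  rw [← pow_mul]
  exact v_pow_ne_one (by positivity)

lemma orderGE_mono (s : ℤ) (m n : ℕ) : OrderGE (m + n) (mono γ s m n) := by
  intro p hp
  rw [mono_apply, if_neg]
  rintro rfl
  exact absurd hp (lt_irrefl _)

lemma smul_mono (c s : ℤ) (m n : ℕ) : v ^ c • mono γ s m n = mono γ (s + c) m n := by
  refine ext fun p => ?_
  rw [smul_apply, mono_apply, mono_apply]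
  split_ifs
  · rw [← zpow_add₀ v_ne_zero]; congr 1; ring
  · rw [mul_zero]

lemma mono_mul_mono (s t : ℤ) (m n m' n' : ℕ) : mono γ s m n * mono γ t m' n' =
    mono γ (s + t + γ * (n * m' - m * n')) (m + m') (n + n') := by
  refine ext fun p => ?_
  rw [mul_apply, mono_apply]
  split_ifs with h
  · subst h
    rw [sum_eq_single m, sum_eq_single n]
    · simp only [mono_apply, add_tsub_cancel_left, if_true]
      rw [← zpow_natCast, ← zpow_add₀ v_ne_zero, ← zpow_add₀ v_ne_zero]
      congr 1
      push_cast
      ring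
    · intro b _ hb
      simp [mono_apply, hb]
    · intro h; exact absurd (mem_range.2 (by dsimp only; omega)) h
    · intro a _ ha
      exact sum_eq_zero fun b _ => by simp [mono_apply, ha]
    · intro h; exact absurd (mem_range.2 (by dsimp only; omega)) h
  · refine sum_eq_zero fun a ha => sum_eq_zero fun b hb => ?_
    rw [mono_apply, mono_apply]
    split_ifs with h1 h2
    · refine absurd ?_ h
      have h3 := mem_range.1 ha
      have h4 := mem_range.1 hb
      simp only [Prod.mk.injEq] at h1 h2
      ext <;> dsimp only <;> omega
    all_goals simp

/-- The truncation of `Ψ_{v^e}(v^s·y^{(m,n)})`, set to `1` when `(m,n) = (0,0)`. -/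
def truncPsi (γ d e : ℕ) (s : ℤ) (m n : ℕ) : Trunc γ d :=
  if m + n = 0 then 1 else evalTrunc d (toTrunc γ d (mono γ s m n)) (dilogSeries (v ^ e))

lemma toTrunc_psi_mono {d : ℕ} (hd : 0 < d) (e : ℕ) (s : ℤ) {m n : ℕ} (h : 0 < m + n) :
    toTrunc γ d (psi (v ^ e) (mono γ s m n)) = truncPsi γ d e s m n := by
  rw [truncPsi, if_neg h.ne']
  exact toTrunc_psi hd _ fun p hp => orderGE_mono s m n p (by omega)

lemma toTrunc_mono_pow {d : ℕ} (s : ℤ) {m n : ℕ} (h : 0 < m + n) :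
    toTrunc γ d (mono γ s m n) ^ d = 0 := by
  have h1 : OrderGE 1 (mono γ s m n) := fun p hp => orderGE_mono s m n p (by omega)
  rw [← map_pow]
  exact toTrunc_eq_zero (h1.pow d) le_rfl

/-- The truncated quantum dilogarithms satisfy the fission and pentagon relations. -/
def psiSystem (γ d : ℕ) (hd : 0 < d) : PsiSystem γ d (Trunc γ d) where
  P := truncPsi γ d
  fission {e} s {m n} he h := by
    have h1 : (v ^ e : K) • mono γ s m n = mono γ (s + e) m n := by
      rw [← smul_mono, zpow_natCast]
    have h2 : (v ^ e : K)⁻¹ • mono γ s m n = mono γ (s - e) m n := by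
      rw [sub_eq_add_neg, ← smul_mono, zpow_neg, zpow_natCast]
    simp only [truncPsi, if_neg h.ne']
    rw [← h1, ← h2, map_smul, map_smul, ← evalTrunc_rescale, ← evalTrunc_rescale, mul_comm 2 e,
      pow_mul, ← evalTrunc_mul (toTrunc_mono_pow s h),
      ← dilogSeries_fission (pow_ne_zero _ v_ne_zero) (v_pow_pow_ne_one he)]
  pentagon {e} s t {m n m' n'} he h := by
    have hu := PsiSystem.pos_left_of_det he h
    have hw := PsiSystem.pos_right_of_det he h
    have h1 : mono γ s m n * mono γ t m' n' = (v ^ e) ^ 2 • (mono γ t m' n' * mono γ s m n) := by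
      rw [mono_mul_mono, mono_mul_mono, ← pow_mul, ← zpow_natCast, smul_mono, add_comm m',
        add_comm n']
      congr 1
      push_cast
      linear_combination 2 * h
    have h2 : v ^ e • (mono γ t m' n' * mono γ s m n) = mono γ (s + t) (m + m') (n + n') := by
      rw [mono_mul_mono, ← zpow_natCast, smul_mono, add_comm m', add_comm n']
      congr 1
      linear_combination -h
    simp only [truncPsi, if_neg hu.ne', if_neg hw.ne', if_neg (show m + m' + (n + n') ≠ 0 by omega)]
    rw [← h2, map_smul, map_mul]
    refine evalTrunc_pentagon (pow_ne_zero _ v_ne_zero) (v_pow_pow_ne_one he) ?_ fun i j hij => ?_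
    · rw [← map_mul, h1, map_smul, map_mul]
    · have hU : OrderGE 1 (mono γ s m n) := fun p hp => orderGE_mono s m n p (by omega)
      have hV : OrderGE 1 (mono γ t m' n') := fun p hp => orderGE_mono t m' n' p (by omega)
      rw [← map_pow, ← map_pow, ← map_mul]
      exact toTrunc_eq_zero ((hV.pow i).mul (hU.pow j)) hij
  commute e e' s t {m n m' n'} h := by
    unfold truncPsi
    split_ifs
    · exact Commute.one_left _
    · exact Commute.one_left _
    · exact Commute.one_right _
    · refine Commute.evalTrunc ?_ _ _
      have hz : (n : ℤ) * m' = m * n' := by exact_mod_cast h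
      have h1 : Commute (mono γ s m n) (mono γ t m' n') := by
        rw [Commute, SemiconjBy, mono_mul_mono, mono_mul_mono, add_comm m', add_comm n']
        congr 1
        linear_combination 2 * (γ : ℤ) * hz
      exact h1.map (toTrunc γ d)
  vanish e s {m n} h := by
    rw [truncPsi]
    split_ifs
    · rfl
    · rw [toTrunc_eq_zero (orderGE_mono s m n) h, evalTrunc_zero hd, dilogSeries,
        coeff_zero_expSeries, one_smul]

lemma qprodR_eq (g : ℕ → QAlg γ) (N : ℕ) : qprodR γ g 0 N = fwdProd g (N + 1) := by
  rw [fwdProd, List.range_eq_range', List.prod_eq_foldr]; rfl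

lemma qprodL_eq (g : ℕ → QAlg γ) (N : ℕ) : qprodL γ g 0 N = bwdProd g (N + 1) := by
  rw [bwdProd, List.range_eq_range', List.prod_eq_foldr]; rfl

/-- The expansion of affine type `A₂⁽²⁾` in the truncations of the quantum plane. -/
theorem toTrunc_expansion_A22 {f d : ℕ} (hf : 0 < f) (hd : 0 < d) (β β' : ℤ) :
    toTrunc (4 * f) d
      (fwdProd (fun p : ℕ =>
          psi (v ^ (4 * f))
              (mono _ ((2 * (p : ℤ) + 1) * β + 4 * (p : ℤ) * β') (2 * p + 1) (4 * p)) *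
            psi (v ^ f)
              (mono _ (((p : ℤ) + 1) * β + (2 * (p : ℤ) + 1) * β') (p + 1) (2 * p + 1))) (d + 1) *
        (psi (v ^ (2 * f)) (mono _ (β + 2 * β') 1 2) *
          (fwdProd (fun p : ℕ =>
              psi (v ^ (2 ^ (p + 1) * f))
                  (mono _ ((2 ^ p : ℤ) * (β + 2 * β') - (2 ^ (p + 1) : ℤ) * (f : ℤ))
                    (2 ^ p) (2 ^ (p + 1))) *
                psi (v ^ (2 ^ (p + 1) * f))
                  (mono _ ((2 ^ p : ℤ) * (β + 2 * β') + (2 ^ (p + 1) : ℤ) * (f : ℤ))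
                    (2 ^ p) (2 ^ (p + 1)))) (d + 1) *
            bwdProd (fun p : ℕ =>
              psi (v ^ (4 * f))
                  (mono _ ((2 * (p : ℤ) + 1) * β + (4 * (p : ℤ) + 4) * β') (2 * p + 1)
                    (4 * p + 4)) *
                psi (v ^ f)
                  (mono _ ((p : ℤ) * β + (2 * (p : ℤ) + 1) * β') p (2 * p + 1))) (d + 1)))) =
    toTrunc (4 * f) d (psi (v ^ f) (mono _ β' 0 1) * psi (v ^ (4 * f)) (mono _ β 1 0)) := by
  rw [map_mul, map_mul, map_mul, map_mul, map_fwdProd, map_fwdProd, map_bwdProd,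
    toTrunc_psi_mono hd _ _ (show 0 < 0 + 1 by norm_num),
    toTrunc_psi_mono hd _ _ (show 0 < 1 + 0 by norm_num),
    toTrunc_psi_mono hd _ _ (show 0 < 1 + 2 by norm_num)]
  refine Eq.trans ?_ ((psiSystem (4 * f) d hd).expansion_A22 β β' hf).symm
  refine congrArg₂ _ (fwdProd_congr (fun p => ?_) _) (congrArg₂ _ rfl (congrArg₂ _
    (fwdProd_congr (fun p => ?_) _) (bwdProd_congr (fun p => ?_) _)))
  · rw [map_mul, toTrunc_psi_mono hd _ _ (by omega), toTrunc_psi_mono hd _ _ (by omega)]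
    rfl
  · have hpos : 0 < 2 ^ p + 2 ^ (p + 1) := by positivity
    rw [map_mul, toTrunc_psi_mono hd _ _ hpos, toTrunc_psi_mono hd _ _ hpos]
    exact congrArg₂ _
      ((psiSystem (4 * f) d hd).congr (by ring) (by push_cast; ring) (by ring) (by ring))
      ((psiSystem (4 * f) d hd).congr (by ring) (by push_cast; ring) (by ring) (by ring))
  · rw [map_mul, toTrunc_psi_mono hd _ _ (by omega), toTrunc_psi_mono hd _ _ (by omega)]
    rfl

end QAlg

end QuantumPlaneRing


/-- Theorem A.7: ordered product expansion of affine type `A₂⁽²⁾`: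
in `A_{4f}`,
`Ψ_{v^f}(v^{β'}Y₂)·Ψ_{v^{4f}}(v^{β}Y₁)
 = (→∏_{p≥0} [Ψ_{v^{4f}}(v^{(2p+1)β+4pβ'}y^{(2p+1,4p)})·Ψ_{v^f}(v^{(p+1)β+(2p+1)β'}y^{(p+1,2p+1)})])·
   Ψ_{v^{2f}}(v^{β+2β'}y^{(1,2)})·
   (∏_{p≥0} Ψ_{v^{2^{p+1}f}}(v^{2^p(β+2β')−2^{p+1}f}y^{(2^p,2^{p+1})})·
            Ψ_{v^{2^{p+1}f}}(v^{2^p(β+2β')+2^{p+1}f}y^{(2^p,2^{p+1})}))·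
   (←∏_{p≥0} [Ψ_{v^{4f}}(v^{(2p+1)β+(4p+4)β'}y^{(2p+1,4p+4)})·Ψ_{v^f}(v^{pβ+(2p+1)β'}y^{(p,2p+1)})])`,
the right-hand side understood as the coefficientwise limit of the partial ordered products. -/
theorem theorem_A7 (f : ℕ) (hf : 0 < f) (β β' : ℤ) :
    ∀ x, ∀ᶠ N in atTop,
      qmul (4 * f)
        (qprodR (4 * f)
          (fun p => qmul (4 * f)
            (qPsi (4 * f) (v ^ (4 * f))
              (qy (4 * f) ((2 * (p : ℤ) + 1) * β + 4 * (p : ℤ) * β') (2 * p + 1) (4 * p)))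
            (qPsi (4 * f) (v ^ f)
              (qy (4 * f) (((p : ℤ) + 1) * β + (2 * (p : ℤ) + 1) * β') (p + 1) (2 * p + 1)))) 0 N)
        (qmul (4 * f)
          (qPsi (4 * f) (v ^ (2 * f)) (qy (4 * f) (β + 2 * β') 1 2))
          (qmul (4 * f)
            (qprodR (4 * f)
              (fun p => qmul (4 * f)
                (qPsi (4 * f) (v ^ (2 ^ (p + 1) * f))
                  (qy (4 * f)
                    ((2 ^ p : ℤ) * (β + 2 * β') - (2 ^ (p + 1) : ℤ) * (f : ℤ))
                    (2 ^ p) (2 ^ (p + 1))))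
                (qPsi (4 * f) (v ^ (2 ^ (p + 1) * f))
                  (qy (4 * f)
                    ((2 ^ p : ℤ) * (β + 2 * β') + (2 ^ (p + 1) : ℤ) * (f : ℤ))
                    (2 ^ p) (2 ^ (p + 1))))) 0 N)
            (qprodL (4 * f)
              (fun p => qmul (4 * f)
                (qPsi (4 * f) (v ^ (4 * f))
                  (qy (4 * f)
                    ((2 * (p : ℤ) + 1) * β + (4 * (p : ℤ) + 4) * β') (2 * p + 1) (4 * p + 4)))
                (qPsi (4 * f) (v ^ f)
                  (qy (4 * f) ((p : ℤ) * β + (2 * (p : ℤ) + 1) * β') p (2 * p + 1)))) 0 N))) x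
      = qmul (4 * f) (qPsi (4 * f) (v ^ f) (qy (4 * f) β' 0 1))
          (qPsi (4 * f) (v ^ (4 * f)) (qy (4 * f) β 1 0)) x := by
  intro x
  filter_upwards [eventually_gt_atTop (x.1 + x.2)] with N hN
  have key := QAlg.toTrunc_eq_iff.1
    (QAlg.toTrunc_expansion_A22 hf (Nat.zero_lt_of_lt hN) β β') x hN
  rw [← QAlg.qprodR_eq, ← QAlg.qprodR_eq, ← QAlg.qprodL_eq] at key
  exact key
end
end

section
/- (Degree-4 triple-sum resummation formula.) For every positive integer p, the identity (1 − x²)(1 − x⁴)(1 − x⁶) · Σ_{j=1}^{p−2} Σ_{t=1}^{p−j−1} Σ_{s=1}^{t} x^{−2j+2t+2s} = x^{8−2p}·(1 − x^{2p−4})(1 − x^{2p−2})(1 − x^{2p}) holds in ℤ[x, x⁻¹]; moreover, if p ≡ 0 (mod 3) then Σ_{j=1}^{p−2} Σ_{t=1}^{p−j−1} Σ_{s=1}^{t} x^{−2j+2t+2s} = Σ_{j=1}^{p/3} Σ_{t=1}^{p−2} Σ_{s=1}^{t} x^{4−6j+2t+2s}. -/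
noncomputable section

/-- The monomial `x^n` (with `n ∈ ℤ`) in the ring `ℤ[x, x⁻¹]` of Laurent polynomials. -/
def t (n : ℤ) : LaurentPolynomial ℤ := LaurentPolynomial.T n

open Finset in
/-- The geometric sum without its constant term. -/
theorem one_sub_mul_sum_Icc_pow {R : Type*} [CommRing R] (y : R) (n : ℕ) :
    (1 - y) * ∑ s ∈ Icc 1 n, y ^ s = y * (1 - y ^ n) := by
  induction n with
  | zero => simp
  | succ n ih =>
    rw [sum_Icc_succ_top (by omega), mul_add, ih]
    ring

open Finset in
/-- Closed form of the sum of `y ^ (u + s)` over `1 ≤ s ≤ u ≤ n`. -/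
theorem mul_sum_Icc_sum_Icc_pow {R : Type*} [CommRing R] (y : R) (n : ℕ) :
    (1 - y) * (1 - y ^ 2) * ∑ u ∈ Icc 1 n, ∑ s ∈ Icc 1 u, y ^ (u + s)
      = y ^ 2 * ((1 - y ^ n) * (1 - y ^ (n + 1))) := by
  induction n with
  | zero => simp
  | succ n ih =>
    rw [sum_Icc_succ_top (by omega), mul_add, ih]
    simp only [pow_add y (n + 1), ← mul_sum]
    linear_combination (1 - y ^ 2) * y ^ (n + 1) * one_sub_mul_sum_Icc_pow y (n + 1)

open Finset in
/-- Closed form of the sum of `y ^ (k + u + s)` over `1 ≤ s ≤ u ≤ k ≤ n`. -/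
theorem mul_sum_Icc_pow_mul_sum_Icc_sum_Icc_pow {R : Type*} [CommRing R] (y : R) (n : ℕ) :
    (1 - y) * (1 - y ^ 2) * (1 - y ^ 3) *
        ∑ k ∈ Icc 1 n, y ^ k * ∑ u ∈ Icc 1 k, ∑ s ∈ Icc 1 u, y ^ (u + s)
      = y ^ 3 * ((1 - y ^ n) * ((1 - y ^ (n + 1)) * (1 - y ^ (n + 2)))) := by
  induction n with
  | zero => simp
  | succ n ih =>
    rw [sum_Icc_succ_top (by omega), mul_add, ih]
    linear_combination (1 - y ^ 3) * y ^ (n + 1) * mul_sum_Icc_sum_Icc_pow y (n + 1)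

theorem t_add (a b : ℤ) : t (a + b) = t a * t b := LaurentPolynomial.T_add a b

theorem t_zero : t 0 = 1 := LaurentPolynomial.T_zero

theorem t_two_mul_natCast (n : ℕ) : t (2 * (n : ℤ)) = t 2 ^ n := by
  rw [t, t, LaurentPolynomial.T_pow, mul_comm]

theorem one_sub_t_ne_zero {n : ℤ} (hn : n ≠ 0) : 1 - t n ≠ 0 := by
  rw [sub_ne_zero, ← t_zero]
  intro h
  exact hn (AddMonoidAlgebra.of_injective (R := ℤ) (M := ℤ) (a₁ := .ofAdd n) (a₂ := .ofAdd 0) h.symm)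

open Finset in
/-- Factoring the shift `a` out of a double sum of monomials. -/
theorem sum_Icc_sum_Icc_t_add (a : ℤ) (n : ℕ) :
    ∑ u ∈ Icc 1 n, ∑ s ∈ Icc 1 u, t (a + 2 * (u : ℤ) + 2 * (s : ℤ))
      = t a * ∑ u ∈ Icc 1 n, ∑ s ∈ Icc 1 u, t 2 ^ (u + s) := by
  simp only [t_add, t_two_mul_natCast, pow_add, mul_sum, mul_assoc]

open Finset in
/-- Closed form of the sum over `1 ≤ j ≤ n` and `1 ≤ s ≤ u ≤ n + 1 - j`. -/
theorem mul_sum_Icc_triple_t (n : ℕ) :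
    (1 - t 2) * (1 - t 4) * (1 - t 6) *
        ∑ j ∈ Icc 1 n, ∑ u ∈ Icc 1 (n + 2 - j - 1), ∑ s ∈ Icc 1 u,
          t (-2 * (j : ℤ) + 2 * (u : ℤ) + 2 * (s : ℤ))
      = t (4 - 2 * (n : ℤ)) *
          ((1 - t 2 ^ n) * ((1 - t 2 ^ (n + 1)) * (1 - t 2 ^ (n + 2)))) := by
  have h4 : t 4 = t 2 ^ 2 := t_two_mul_natCast 2
  have h6 : t 6 = t 2 ^ 3 := t_two_mul_natCast 3
  have hs : ∑ j ∈ Icc 1 n, ∑ u ∈ Icc 1 (n + 2 - j - 1), ∑ s ∈ Icc 1 u,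
        t (-2 * (j : ℤ) + 2 * (u : ℤ) + 2 * (s : ℤ))
      = t (-2 * (n : ℤ) - 2) *
        ∑ k ∈ Icc 1 n, t 2 ^ k * ∑ u ∈ Icc 1 k, ∑ s ∈ Icc 1 u, t 2 ^ (u + s) := by
    rw [mul_sum]
    refine sum_nbij' (fun j => n + 1 - j) (fun k => n + 1 - k) ?_ ?_ ?_ ?_ ?_ <;>
      intro j hj <;> rw [mem_Icc] at hj
    · rw [mem_Icc]; omega
    · rw [mem_Icc]; omega
    · omega
    · omega
    · rw [sum_Icc_sum_Icc_t_add, show n + 2 - j - 1 = n + 1 - j by omega, ← mul_assoc,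
        ← t_two_mul_natCast, ← t_add]
      congr 2
      push_cast [show j ≤ n + 1 by omega]
      ring
  have ht : t (4 - 2 * (n : ℤ)) = t (-2 * (n : ℤ) - 2) * t 2 ^ 3 := by
    rw [← h6, ← t_add]
    congr 1
    ring
  rw [hs, h4, h6, ht]
  linear_combination t (-2 * (n : ℤ) - 2) * mul_sum_Icc_pow_mul_sum_Icc_sum_Icc_pow (t 2) n

open Finset in
theorem mul_sum_Icc_t_sub_six_mul (m : ℕ) :
    (1 - t 6) * ∑ j ∈ Icc 1 m, t (4 - 6 * (j : ℤ))
      = t (4 - 6 * (m : ℤ)) * (1 - t (6 * (m : ℤ))) := by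
  induction m with
  | zero => simp [t_zero]
  | succ m ih =>
    rw [sum_Icc_succ_top (by omega), mul_add, ih]
    simp only [mul_sub, sub_mul, one_mul, mul_one, ← t_add]
    push_cast
    ring_nf

/-- degree-4 triple-sum resummation formula: for every positive integer `p`,
`(1 − x²)(1 − x⁴)(1 − x⁶)·Σ_{j=1}^{p−2} Σ_{t=1}^{p−j−1} Σ_{s=1}^{t} x^{−2j+2t+2s}
 = x^{8−2p}(1 − x^{2p−4})(1 − x^{2p−2})(1 − x^{2p})`; moreover, if `3 ∣ p` then the triple sum
equals `Σ_{j=1}^{p/3} Σ_{t=1}^{p−2} Σ_{s=1}^{t} x^{4−6j+2t+2s}`. -/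
theorem degree_four_triple_resummation (p : ℕ) (hp : 0 < p) :
    ((1 - t 2) * (1 - t 4) * (1 - t 6) *
        ∑ j ∈ Finset.Icc 1 (p - 2), ∑ u ∈ Finset.Icc 1 (p - j - 1), ∑ s ∈ Finset.Icc 1 u,
          t (-2 * (j : ℤ) + 2 * (u : ℤ) + 2 * (s : ℤ))
      = t (8 - 2 * (p : ℤ)) *
          ((1 - t (2 * (p : ℤ) - 4)) * ((1 - t (2 * (p : ℤ) - 2)) * (1 - t (2 * (p : ℤ))))))
    ∧
    (3 ∣ p →
      (∑ j ∈ Finset.Icc 1 (p - 2), ∑ u ∈ Finset.Icc 1 (p - j - 1), ∑ s ∈ Finset.Icc 1 u,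
          t (-2 * (j : ℤ) + 2 * (u : ℤ) + 2 * (s : ℤ)))
        = ∑ j ∈ Finset.Icc 1 (p / 3), ∑ u ∈ Finset.Icc 1 (p - 2), ∑ s ∈ Finset.Icc 1 u,
            t (4 - 6 * (j : ℤ) + 2 * (u : ℤ) + 2 * (s : ℤ))) := by
  have h4 : t 4 = t 2 ^ 2 := t_two_mul_natCast 2
  obtain rfl | ⟨n, rfl⟩ : p = 1 ∨ ∃ n, p = n + 2 := by
    obtain h | h : p = 1 ∨ 2 ≤ p := by omega
    · exact Or.inl h
    · exact Or.inr ⟨p - 2, by omega⟩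
  · simp [t_zero]
  · have key := mul_sum_Icc_triple_t n
    rw [Nat.add_sub_cancel]
    refine ⟨?_, ?_⟩
    · rw [key, ← t_two_mul_natCast, ← t_two_mul_natCast, ← t_two_mul_natCast]
      push_cast
      ring_nf
    · rintro ⟨m, hm⟩
      have hne : (1 - t 2) * (1 - t 4) * (1 - t 6) ≠ 0 :=
        mul_ne_zero (mul_ne_zero (one_sub_t_ne_zero (by norm_num))
          (one_sub_t_ne_zero (by norm_num))) (one_sub_t_ne_zero (by norm_num))
      apply mul_left_cancel₀ hne
      rw [key]
      simp only [sum_Icc_sum_Icc_t_add, ← Finset.sum_mul]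
      have hdiv : (n + 2) / 3 = m := by omega
      have hexp : 6 * (m : ℤ) = 2 * ((n + 2 : ℕ) : ℤ) := by omega
      have hgeom := mul_sum_Icc_t_sub_six_mul m
      have hpair := mul_sum_Icc_sum_Icc_pow (t 2) n
      have ht : t (4 - 2 * (n : ℤ)) = t (4 - 2 * ((n + 2 : ℕ) : ℤ)) * t 4 := by
        rw [← t_add]
        congr 1
        push_cast
        ring
      rw [← h4] at hpair
      rw [hexp, t_two_mul_natCast] at hgeom
      rw [hdiv, ht]
      linear_combination
        -((1 - t 6) * ∑ j ∈ Finset.Icc 1 m, t (4 - 6 * (j : ℤ))) * hpair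
          - t 4 * ((1 - t 2 ^ n) * (1 - t 2 ^ (n + 1))) * hgeom
end
end

section
/- (Positivity of B_k, the main claim of Appendix B.) For every positive integer k that is not divisible by 3, there exists a polynomial P ∈ ℤ[x] all of whose coefficients are nonnegative such that P(x) · (1 − x⁴)(1 − x⁶)(1 − x^{2k}) = (1 − x^{6k−4})(1 − x^{6k−2})(1 − x^{6k}) in ℤ[x]. (Equivalently, the rational function B_k(x) = (1 − x^{6k−4})(1 − x^{6k−2})(1 − x^{6k}) / ((1 − x⁴)(1 − x⁶)(1 − x^{2k})) is a polynomial with nonnegative integer coefficients; this is equivalent to the positivity at degree 4 in direction (1,3) of the quantum cluster scattering diagram with (δ₁, δ₂) = (3, 3k) for k ≢ 0 mod 3.) -/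
open Polynomial

/-- For `k` prime to `3` and `m + 1 ≥ 2k`, the quotient
`(1 + x^k + x^{2k}) (1 - x^m) / (1 - x³)`, evaluated at `x = q`, is a polynomial in `q` with
natural number coefficients. -/
theorem exists_nat_quotient_one_sub_pow_three (q : ℕ[X]) {k m : ℕ} (h3 : ¬ 3 ∣ k)
    (hm : 2 * k ≤ m + 1) :
    ∃ R : ℕ[X], mapRingHom (Nat.castRingHom ℤ) R * (1 - mapRingHom (Nat.castRingHom ℤ) q ^ 3)
      = (1 + mapRingHom (Nat.castRingHom ℤ) q ^ k + mapRingHom (Nat.castRingHom ℤ) q ^ (2 * k))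
        * (1 - mapRingHom (Nat.castRingHom ℤ) q ^ m) := by
  rcases (by omega : k % 3 = 1 ∨ k % 3 = 2) with h | h
  · obtain ⟨j, rfl⟩ : ∃ j, k = 3 * j + 1 := ⟨k / 3, by omega⟩
    obtain ⟨d, rfl⟩ : ∃ d, m = 6 * j + d := ⟨m - 6 * j, by omega⟩
    refine ⟨∑ i ∈ Finset.range (2 * j), (q ^ 3) ^ i
      + q ^ (3 * j + 1) * ∑ i ∈ Finset.range j, (q ^ 3) ^ i
      + q ^ (6 * j) * ∑ i ∈ Finset.range d, q ^ i
      + q ^ (6 * j + d) * (q * ∑ i ∈ Finset.range j, (q ^ 3) ^ i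
        + q ^ 2 * ∑ i ∈ Finset.range (2 * j), (q ^ 3) ^ i), ?_⟩
    simp only [map_add, map_mul, map_pow, map_sum]
    generalize mapRingHom (Nat.castRingHom ℤ) q = x
    linear_combination (1 + x ^ (6 * j + d) * x ^ 2) * geom_sum_mul_neg (x ^ 3) (2 * j)
      + (x ^ (3 * j + 1) + x ^ (6 * j + d) * x) * geom_sum_mul_neg (x ^ 3) j
      + x ^ (6 * j) * (1 + x + x ^ 2) * geom_sum_mul_neg x d
  · obtain ⟨j, rfl⟩ : ∃ j, k = 3 * j + 2 := ⟨k / 3, by omega⟩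
    obtain ⟨d, rfl⟩ : ∃ d, m = 6 * j + 3 + d := ⟨m - (6 * j + 3), by omega⟩
    refine ⟨∑ i ∈ Finset.range (2 * j + 1), (q ^ 3) ^ i
      + q ^ (3 * j + 2) * ∑ i ∈ Finset.range (j + 1), (q ^ 3) ^ i
      + q ^ (6 * j + 3) * ∑ i ∈ Finset.range d, q ^ i
      + q ^ (6 * j + 3 + d) * (q ^ 2 * ∑ i ∈ Finset.range j, (q ^ 3) ^ i
        + q * ∑ i ∈ Finset.range (2 * j + 1), (q ^ 3) ^ i), ?_⟩
    simp only [map_add, map_mul, map_pow, map_sum]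
    generalize mapRingHom (Nat.castRingHom ℤ) q = x
    linear_combination
      (1 + x ^ (6 * j + 3 + d) * x) * geom_sum_mul_neg (x ^ 3) (2 * j + 1)
      + x ^ (3 * j + 2) * geom_sum_mul_neg (x ^ 3) (j + 1)
      + x ^ (6 * j + 3 + d) * x ^ 2 * geom_sum_mul_neg (x ^ 3) j
      + x ^ (6 * j + 3) * (1 + x + x ^ 2) * geom_sum_mul_neg x d

/-- positivity of `B_k`, the main claim of Appendix B: for every positive
integer `k` not divisible by `3`, there is a polynomial `P ∈ ℤ[x]` with nonnegative
coefficients such that `P(x)·(1 − x⁴)(1 − x⁶)(1 − x^{2k})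
= (1 − x^{6k−4})(1 − x^{6k−2})(1 − x^{6k})` in `ℤ[x]`. -/
theorem Bk_positivity (k : ℕ) (hk : 0 < k) (h3 : ¬ (3 ∣ k)) :
    ∃ P : Polynomial ℤ, (∀ n, 0 ≤ P.coeff n) ∧
      P * ((1 - X ^ 4) * (1 - X ^ 6) * (1 - X ^ (2 * k)))
        = (1 - X ^ (6 * k - 4)) * (1 - X ^ (6 * k - 2)) * (1 - X ^ (6 * k)) := by
  obtain ⟨m, h, hm, hprod⟩ : ∃ m h : ℕ, 2 * k ≤ m + 1 ∧
      (1 - X ^ (6 * k - 4)) * (1 - X ^ (6 * k - 2))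
        = ((1 - X ^ (2 * m)) * (1 - X ^ (4 * h)) : ℤ[X]) := by
    rcases Nat.even_or_odd' k with ⟨c, rfl | rfl⟩
    · refine ⟨6 * c - 1, 3 * c - 1, by omega, ?_⟩
      rw [show 6 * (2 * c) - 4 = 4 * (3 * c - 1) by omega,
        show 6 * (2 * c) - 2 = 2 * (6 * c - 1) by omega, mul_comm]
    · refine ⟨6 * c + 1, 3 * c + 1, by omega, ?_⟩
      rw [show 6 * (2 * c + 1) - 4 = 2 * (6 * c + 1) by omega,
        show 6 * (2 * c + 1) - 2 = 4 * (3 * c + 1) by omega]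
  obtain ⟨R, hR⟩ := exists_nat_quotient_one_sub_pow_three (X ^ 2) h3 hm
  refine ⟨mapRingHom (Nat.castRingHom ℤ) (R * ∑ i ∈ Finset.range h, (X ^ 4) ^ i),
    fun n => by simp only [coe_mapRingHom, coeff_map]; exact Int.natCast_nonneg _, ?_⟩
  rw [hprod]
  simp only [map_mul, map_sum, map_pow, coe_mapRingHom, map_X] at hR ⊢
  linear_combination
    (1 - X ^ (2 * k)) * (1 - X ^ (4 * h)) * hR
      + map (Nat.castRingHom ℤ) R * (1 - X ^ 6) * (1 - X ^ (2 * k))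
        * geom_sum_mul_neg (X ^ 4 : ℤ[X]) h
end
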